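/- arXiv:2405.17415 — 2 statements merged into one kernel-verified Lean document; each statement's English description precedes it below -/
import Mathlib

section
/- Let ω be a germ of holomorphic 1-form at 0 ∈ ℂ^n such that the rank of the linear part of ω is at least p+1, where p is a nonnegative integer. Then ω satisfies the division property by k-forms for every k ≤ p; that is, for every germ of holomorphic k-form α at 0 with ω ∧ α = 0 there exists a germ of holomorphic (k−1)-form β at 0 with α = ω ∧ β. -/
open Topology Filter Set
open scoped ENNReal Manifold

noncomputable section

/-- `ℂⁿ`. -/
abbrev Cn (n : ℕ) : Type := Fin n → ℂ

/-- Holomorphic `m`-forms on (open subsets of) `ℂⁿ`, as alternating-map valued functions. -/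
abbrev Form (n m : ℕ) : Type := Cn n → AlternatingMap ℂ (Cn n) ℂ (Fin m)

/-- Vector fields on (open subsets of) `ℂⁿ`. -/
abbrev VF (n : ℕ) : Type := Cn n → Cn n

/-- A form is holomorphic on `U` if all its coefficient functions are. -/
def HolFormOn {n m : ℕ} (U : Set (Cn n)) (ω : Form n m) : Prop :=
  ∀ v : Fin m → Cn n, AnalyticOnNhd ℂ (fun z => ω z v) U

/-- A form is holomorphic at (a neighborhood of) a point `c`. -/
def HolFormAt {n m : ℕ} (c : Cn n) (ω : Form n m) : Prop :=
  ∀ v : Fin m → Cn n, AnalyticAt ℂ (fun z => ω z v) c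

/-- The zero locus (singular set) of a form. -/
def zeroLocus {n m : ℕ} (ω : Form n m) : Set (Cn n) := {z | ω z = 0}

/-- `V ⊆ ℂⁿ` has (complex) codimension at least `c`; via Hausdorff dimension
(a complex-analytic set of complex dimension `d` has Hausdorff dimension `2d`).
The empty set has codimension `≥ c` for every `c`. -/
def CodimGE (n : ℕ) (V : Set (Cn n)) (c : ℕ) : Prop :=
  V = ∅ ∨ dimH V + 2 * (c : ℝ≥0∞) ≤ 2 * (n : ℝ≥0∞)

/-- The germ of `V` at `c` has codimension at least `k`. -/
def GermCodimGE (n : ℕ) (c : Cn n) (V : Set (Cn n)) (k : ℕ) : Prop :=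
  ∃ U ∈ 𝓝 c, CodimGE n (V ∩ U) k

/-- `i_X (ω) = 0` at the point `z` : the form `ω` annihilates the vector `X z` at `z`. -/
def TangentAt {n m : ℕ} (ω : Form n m) (X : VF n) (z : Cn n) : Prop :=
  ∀ (v : Fin m → Cn n) (i : Fin m), v i = X z → ω z v = 0

/-- `ω` is locally decomposable (as a wedge of holomorphic `1`-forms) at the points
of `U` where it does not vanish. -/
def LocallyDecomp {n m : ℕ} (U : Set (Cn n)) (ω : Form n m) : Prop :=
  ∀ z ∈ U, ω z ≠ 0 → ∃ W ∈ 𝓝 z, W ⊆ U ∧ ∃ η : Fin m → Cn n → (Cn n →ₗ[ℂ] ℂ),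
    (∀ i (v : Cn n), AnalyticOnNhd ℂ (fun w => η i w v) W) ∧
    ∀ w ∈ W, ∀ v : Fin m → Cn n, ω w v = Matrix.det (Matrix.of fun i j => η i w (v j))

/-- The rank of the derivative (linear part) of a vector field at a point. -/
def rkAt {n : ℕ} (X : VF n) (z : Cn n) : ℕ :=
  Module.finrank ℂ (LinearMap.range (fderiv ℂ X z).toLinearMap)

/-- The germ at `c` of the vector field `X` divides the germ of the `m`-form `ω`:
`ω = i_X Θ` for some germ of holomorphic `(m+1)`-form `Θ`. -/
def DividesAt {n m : ℕ} (X : VF n) (ω : Form n m) (c : Cn n) : Prop :=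
  ∃ Θ : Form n (m + 1), HolFormAt c Θ ∧
    ∀ᶠ z in 𝓝 c, ∀ v : Fin m → Cn n, ω z v = Θ z (Fin.cons (X z) v)

/-- The germ at `0` of an `m`-form defines a singular holomorphic distribution:
it is holomorphic, locally decomposable outside its zero set, and its zero set has
codimension at least two. -/
structure IsGermDist (n m : ℕ) (ω : Form n m) : Prop where
  hol : ∃ U ∈ 𝓝 (0 : Cn n), HolFormOn U ω ∧ LocallyDecomp U ω
  codim : GermCodimGE n 0 (zeroLocus ω) 2

/-- The tangent sheaf of the germ of two-dimensional distribution defined by the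
`m`-form `ω` (`m = n - 2`) is locally free: `ω = i_Y i_Z Θ` for germs of vector fields
`Y, Z` and a germ of `n`-form `Θ`. -/
def GermLocFree2 (n m : ℕ) (ω : Form n m) : Prop :=
  ∃ (Y Z : VF n) (Θ : Form n (m + 2)), AnalyticAt ℂ Y 0 ∧ AnalyticAt ℂ Z 0 ∧ HolFormAt 0 Θ ∧
    ∀ᶠ z in 𝓝 (0 : Cn n), ∀ v : Fin m → Cn n,
      ω z v = Θ z (Fin.cons (Y z) (Fin.cons (Z z) v))

/-- `ω = i_X i_Y Θ` near `0`, for some germ of vector field `Y` and germ of `n`-form `Θ`. -/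
def DivPairAt {n m : ℕ} (X : VF n) (ω : Form n m) : Prop :=
  ∃ (Y : VF n) (Θ : Form n (m + 2)), AnalyticAt ℂ Y 0 ∧ HolFormAt 0 Θ ∧
    ∀ᶠ z in 𝓝 (0 : Cn n), ∀ v : Fin m → Cn n,
      ω z v = Θ z (Fin.cons (X z) (Fin.cons (Y z) v))

/-- The tangent sheaf of the germ of `k`-dimensional distribution defined by the `m`-form
`ω` (`n = k + m`) is locally free: `ω = i_{X_1} ⋯ i_{X_k} Θ`. -/
def GermLocFreeK (n k m : ℕ) (h : n = k + m) (ω : Form n m) : Prop :=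
  ∃ (Xs : Fin k → VF n) (Θ : Form n n), (∀ i, AnalyticAt ℂ (Xs i) 0) ∧ HolFormAt 0 Θ ∧
    ∀ᶠ z in 𝓝 (0 : Cn n), ∀ v : Fin m → Cn n,
      ω z v = Θ z (fun i => Fin.append (fun a => Xs a z) v (Fin.cast h i))

/-- The germs at `c` of the vector fields `Xs` freely generate the germs of vector
fields tangent to the distribution defined by `ω` : every germ of tangent vector field
is a combination of the `Xs` with holomorphic coefficients, and the coefficients in such
combinations are unique (i.e. the `Xs` are independent over the local ring at `c`). -/
def FreeGensAt {n m : ℕ} (ω : Form n m) {k : ℕ} (Xs : Fin k → VF n) (c : Cn n) : Prop :=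
  (∀ Z : VF n, AnalyticAt ℂ Z c → (∀ᶠ z in 𝓝 c, TangentAt ω Z z) →
      ∃ f : Fin k → Cn n → ℂ, (∀ i, AnalyticAt ℂ (f i) c) ∧
        ∀ᶠ z in 𝓝 c, Z z = ∑ i, f i z • Xs i z) ∧
  (∀ f : Fin k → Cn n → ℂ, (∀ i, AnalyticAt ℂ (f i) c) →
      (∀ᶠ z in 𝓝 c, (∑ i, f i z • Xs i z) = 0) → ∀ i, ∀ᶠ z in 𝓝 c, f i z = 0)

/-- Polydiscs in `ℂⁿ`. -/
def IsPolydisc {n : ℕ} (U : Set (Cn n)) : Prop :=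
  ∃ (c : Cn n) (r : Fin n → ℝ), (∀ i, 0 < r i) ∧ U = {z | ∀ i, dist (z i) (c i) < r i}

/-- The wedge product of a `1`-form with a `k`-form, as a function of `k+1` vectors. -/
def wedge1 {n k : ℕ} (ω : Form n 1) (α : Form n k) (z : Cn n) (v : Fin (k + 1) → Cn n) : ℂ :=
  ∑ i : Fin (k + 1), (-1 : ℂ) ^ (i : ℕ) * ω z (fun _ => v i) * α z (fun j => v (i.succAbove j))

/-! ### Analytic subsets of open sets of `ℂᴺ`, irreducibility, components -/

/-- `V` is an analytic subset of `U`: locally (on `U`) it is the common zero set of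
finitely many holomorphic functions. -/
def IsAnalyticIn {N : ℕ} (U V : Set (Cn N)) : Prop :=
  V ⊆ U ∧ ∀ p ∈ U, ∃ W ∈ 𝓝 p, ∃ (r : ℕ) (f : Fin r → Cn N → ℂ),
    (∀ i, AnalyticOnNhd ℂ (f i) W) ∧ ∀ z ∈ W ∩ U, (z ∈ V ↔ ∀ i, f i z = 0)

/-- An irreducible analytic subset of `U`. -/
def IsIrredAnalyticIn {N : ℕ} (U V : Set (Cn N)) : Prop :=
  IsAnalyticIn U V ∧ V.Nonempty ∧
    ∀ V1 V2, IsAnalyticIn U V1 → IsAnalyticIn U V2 → V = V1 ∪ V2 → V = V1 ∨ V = V2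

/-- `C` is an irreducible component of the analytic set `V ⊆ U` : a maximal irreducible
analytic subset of `U` contained in `V`. -/
def IsIrredComponentIn {N : ℕ} (U V C : Set (Cn N)) : Prop :=
  IsIrredAnalyticIn U C ∧ C ⊆ V ∧ ∀ C', IsIrredAnalyticIn U C' → C ⊆ C' → C' ⊆ V → C' = C

/-! ### Distributions and foliations on `ℙⁿ`, in homogeneous coordinates -/

/-- A `k`-dimensional singular holomorphic distribution of degree `d` on `ℙⁿ`, given in
homogeneous coordinates by a homogeneous `(n-k)`-form `ω` on `ℂⁿ⁺¹` (with polynomial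
coefficients of degree `d+1`) satisfying `i_R ω = 0`, locally decomposable outside its
singular set, whose singular set has codimension at least `2`. -/
structure ProjDist (n k : ℕ) where
  d : ℕ
  ω : Form (n + 1) (n - k)
  hol : HolFormOn Set.univ ω
  homog : ∀ (t : ℂ) (z : Cn (n + 1)) (v : Fin (n - k) → Cn (n + 1)),
    ω (t • z) v = t ^ (d + 1) * ω z v
  radial : ∀ (z : Cn (n + 1)) (v : Fin (n - k) → Cn (n + 1)) (i : Fin (n - k)),
    v i = z → ω z v = 0
  decomp : LocallyDecomp Set.univ ω
  codim : CodimGE (n + 1) {z | z ≠ 0 ∧ ω z = 0} 2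

/-- The singular set of a distribution on `ℙⁿ`, as a cone in `ℂⁿ⁺¹ \ {0}`. -/
def ProjDist.coneSing {n k : ℕ} (D : ProjDist n k) : Set (Cn (n + 1)) :=
  {z | z ≠ 0 ∧ D.ω z = 0}

/-- A one-dimensional singular holomorphic foliation of degree `d` on `ℙⁿ`, given in
homogeneous coordinates by a homogeneous polynomial vector field on `ℂⁿ⁺¹`, whose
singular set (points where `V ∧ R = 0`) has codimension at least `2`. -/
structure ProjFol1 (n : ℕ) where
  d : ℕ
  V : VF (n + 1)
  hol : AnalyticOnNhd ℂ V Set.univ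
  homog : ∀ (t : ℂ) (z : Cn (n + 1)), V (t • z) = t ^ d • V z
  codim : CodimGE (n + 1) {z | z ≠ 0 ∧ V z ∈ Submodule.span ℂ {z}} 2

/-- The singular set of a one-dimensional foliation on `ℙⁿ`, as a cone in `ℂⁿ⁺¹ \ {0}`. -/
def ProjFol1.coneSing {n : ℕ} (G : ProjFol1 n) : Set (Cn (n + 1)) :=
  {z | z ≠ 0 ∧ G.V z ∈ Submodule.span ℂ {z}}

/-- The foliation `G` is tangent to the distribution `D` : `i_V ω = 0`. -/
def PTangent {n k : ℕ} (G : ProjFol1 n) (D : ProjDist n k) : Prop :=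
  ∀ (z : Cn (n + 1)) (v : Fin (n - k) → Cn (n + 1)) (i : Fin (n - k)),
    v i = G.V z → D.ω z v = 0

/-- `G` locally divides the two-dimensional distribution `D` at the point of `ℙⁿ`
corresponding to `q ∈ ℂⁿ⁺¹ \ {0}` : in homogeneous coordinates, `ω = i_V i_R Θ` near `q`
for some germ of holomorphic `(n-1)`-form `Θ` (equivalently, in an affine chart at `[q]`,
the defining vector field of `G` divides the defining form of `D`). -/
def PLocDividesAt {n : ℕ} (G : ProjFol1 n) (D : ProjDist n 2) (q : Cn (n + 1)) : Prop :=
  ∃ Θ : Form (n + 1) (n - 2 + 2), HolFormAt q Θ ∧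
    ∀ᶠ z in 𝓝 q, ∀ v : Fin (n - 2) → Cn (n + 1),
      D.ω z v = Θ z (Fin.cons (G.V z) (Fin.cons z v))

/-- The tangent sheaf of the two-dimensional distribution `D` on `ℙⁿ` is locally free:
near every point of `ℂⁿ⁺¹ \ {0}` one can write `ω = i_X i_Y i_R Θ`. -/
def PLocFreeAt {n : ℕ} (D : ProjDist n 2) (q : Cn (n + 1)) : Prop :=
  ∃ (X Y : VF (n + 1)) (Θ : Form (n + 1) (n - 2 + 3)),
    AnalyticAt ℂ X q ∧ AnalyticAt ℂ Y q ∧ HolFormAt q Θ ∧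
    ∀ᶠ z in 𝓝 q, ∀ v : Fin (n - 2) → Cn (n + 1),
      D.ω z v = Θ z (Fin.cons (X z) (Fin.cons (Y z) (Fin.cons z v)))

def PLocFree {n : ℕ} (D : ProjDist n 2) : Prop :=
  ∀ q : Cn (n + 1), q ≠ 0 → PLocFreeAt D q

/-- The linearization, at a singular point `q` (with `ℓ q = 1`), of the vector field
induced on the affine chart `{ℓ = 1}` of `ℙⁿ` by the homogeneous vector field `V`. -/
def projLin {n : ℕ} (V : VF n) (q : Cn n) (ℓ : Cn n →ₗ[ℂ] ℂ) : Cn n →ₗ[ℂ] Cn n :=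
  (fderiv ℂ V q).toLinearMap - LinearMap.smulRight (ℓ ∘ₗ (fderiv ℂ V q).toLinearMap) q
    - ℓ (V q) • LinearMap.id

/-- The linear rank of the one-dimensional foliation `G` on `ℙⁿ` is at least `r` :
at every singular point, the linearization of the vector field induced on an affine
chart has rank at least `r`. -/
def PLinRankGE {n : ℕ} (G : ProjFol1 n) (r : ℕ) : Prop :=
  ∀ q ∈ G.coneSing, ∃ ℓ : Cn (n + 1) →ₗ[ℂ] ℂ, ℓ q = 1 ∧
    r ≤ Module.finrank ℂ (Submodule.map (projLin G.V q ℓ) (LinearMap.ker ℓ))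

/-- `T_D = T_G ⊕ T_H` : in homogeneous coordinates,
`ω = c ⋅ i_{V_G} i_{V_H} i_R (dx_0 ∧ ⋯ ∧ dx_n)` for a nonzero constant `c`. -/
def SplitPair {n : ℕ} (hn : n + 1 = 3 + (n - 2)) (G H : ProjFol1 n) (D : ProjDist n 2) :
    Prop :=
  ∃ c : ℂ, c ≠ 0 ∧ ∀ (z : Cn (n + 1)) (v : Fin (n - 2) → Cn (n + 1)),
    D.ω z v = c * Matrix.det (Matrix.of fun i j =>
      Fin.append ![G.V z, H.V z, z] v (Fin.cast hn i) j)

/-- The tangent sheaf of the two-dimensional distribution `D` on `ℙⁿ` splits as a direct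
sum of two line bundles: `ω = c ⋅ i_{X_1} i_{X_2} i_R (dx_0 ∧ ⋯ ∧ dx_n)` for homogeneous
polynomial vector fields `X_1, X_2` on `ℂⁿ⁺¹`. -/
def PSplits {n : ℕ} (hn : n + 1 = 3 + (n - 2)) (D : ProjDist n 2) : Prop :=
  ∃ (X1 X2 : VF (n + 1)) (d1 d2 : ℕ) (c : ℂ), c ≠ 0 ∧
    AnalyticOnNhd ℂ X1 Set.univ ∧ AnalyticOnNhd ℂ X2 Set.univ ∧
    (∀ (t : ℂ) (z : Cn (n + 1)), X1 (t • z) = t ^ d1 • X1 z) ∧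
    (∀ (t : ℂ) (z : Cn (n + 1)), X2 (t • z) = t ^ d2 • X2 z) ∧
    ∀ (z : Cn (n + 1)) (v : Fin (n - 2) → Cn (n + 1)),
      D.ω z v = c * Matrix.det (Matrix.of fun i j =>
        Fin.append ![X1 z, X2 z, z] v (Fin.cast hn i) j)

/-- The coefficient of the exterior differential of a `1`-form: `dω(a,b)` at `z`. -/
def extd1 {N : ℕ} (ω : Form N 1) (z a b : Cn N) : ℂ :=
  fderiv ℂ (fun y => ω y ![b]) z a - fderiv ℂ (fun y => ω y ![a]) z b

/-- The Frobenius integrability condition `ω ∧ dω = 0` for a `1`-form. -/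
def Integrable1 {N : ℕ} (ω : Form N 1) : Prop :=
  ∀ z a b c : Cn N,
    ω z ![a] * extd1 ω z b c + ω z ![b] * extd1 ω z c a + ω z ![c] * extd1 ω z a b = 0

/-! ### Distributions and foliations on complex manifolds -/

section Manifold

variable {n k : ℕ} {M : Type*} [TopologicalSpace M] [ChartedSpace (Cn n) M]

/-- A `k`-dimensional singular holomorphic distribution on a complex `n`-manifold `M`:
around each point it is given, in the chart at that point, by a holomorphic `(n-k)`-form,
locally decomposable outside its zero set, with zero set of codimension at least 2;
on overlaps the local forms agree up to a nonvanishing holomorphic factor. -/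
structure MDist (n k : ℕ) (M : Type*) [TopologicalSpace M] [ChartedSpace (Cn n) M] where
  ω : M → Form n (n - k)
  dom : M → Set (Cn n)
  dom_open : ∀ p, IsOpen (dom p)
  dom_sub : ∀ p, dom p ⊆ (chartAt (Cn n) p).target
  dom_mem : ∀ p, chartAt (Cn n) p p ∈ dom p
  hol : ∀ p, HolFormOn (dom p) (ω p)
  decomp : ∀ p, LocallyDecomp (dom p) (ω p)
  codim : ∀ p, CodimGE n (zeroLocus (ω p) ∩ dom p) 2
  compat : ∀ p q : M, ∀ x : M, x ∈ (chartAt (Cn n) p).source → x ∈ (chartAt (Cn n) q).source →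
    chartAt (Cn n) p x ∈ dom p → chartAt (Cn n) q x ∈ dom q →
    ∃ W ∈ 𝓝 (chartAt (Cn n) p x), W ⊆ dom p ∧
      ∃ h : Cn n → ℂ, AnalyticOnNhd ℂ h W ∧ (∀ z ∈ W, h z ≠ 0) ∧
      ∀ z ∈ W, ∀ v : Fin (n - k) → Cn n,
        ω p z v = h z * ω q ((chartAt (Cn n) q) ((chartAt (Cn n) p).symm z))
          (fun i => fderiv ℂ (fun y => (chartAt (Cn n) q) ((chartAt (Cn n) p).symm y)) z (v i))

/-- The singular set of a distribution on a manifold. -/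
def MDist.sing (D : MDist n k M) : Set M :=
  {x | D.ω x (chartAt (Cn n) x x) = 0}

/-- A one-dimensional singular holomorphic foliation on a complex `n`-manifold `M`:
around each point it is given, in the chart at that point, by a holomorphic vector field
with singular set of codimension at least 2; on overlaps the local vector fields agree,
up to a nonvanishing holomorphic factor, under the differentials of the transition maps. -/
structure MFol1 (n : ℕ) (M : Type*) [TopologicalSpace M] [ChartedSpace (Cn n) M] where
  V : M → VF n
  dom : M → Set (Cn n)
  dom_open : ∀ p, IsOpen (dom p)
  dom_sub : ∀ p, dom p ⊆ (chartAt (Cn n) p).target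
  dom_mem : ∀ p, chartAt (Cn n) p p ∈ dom p
  hol : ∀ p, AnalyticOnNhd ℂ (V p) (dom p)
  codim : ∀ p, CodimGE n ({z ∈ dom p | V p z = 0}) 2
  compat : ∀ p q : M, ∀ x : M, x ∈ (chartAt (Cn n) p).source → x ∈ (chartAt (Cn n) q).source →
    chartAt (Cn n) p x ∈ dom p → chartAt (Cn n) q x ∈ dom q →
    ∃ W ∈ 𝓝 (chartAt (Cn n) p x), W ⊆ dom p ∧
      ∃ h : Cn n → ℂ, AnalyticOnNhd ℂ h W ∧ (∀ z ∈ W, h z ≠ 0) ∧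
      ∀ z ∈ W,
        fderiv ℂ (fun y => (chartAt (Cn n) q) ((chartAt (Cn n) p).symm y)) z (V p z)
          = h z • V q ((chartAt (Cn n) q) ((chartAt (Cn n) p).symm z))

/-- The singular set of a one-dimensional foliation on a manifold. -/
def MFol1.sing (G : MFol1 n M) : Set M :=
  {x | G.V x (chartAt (Cn n) x x) = 0}

/-- The foliation `G` is tangent to the distribution `D`. -/
def MTangent (G : MFol1 n M) (D : MDist n k M) : Prop :=
  ∀ p : M, ∀ z ∈ G.dom p ∩ D.dom p, TangentAt (D.ω p) (G.V p) z

/-- `G` locally divides `D` at `p` : in the chart at `p`, the germ of the defining vector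
field of `G` divides the germ of the defining form of `D`. -/
def MLocDividesAt (G : MFol1 n M) (D : MDist n k M) (p : M) : Prop :=
  DividesAt (G.V p) (D.ω p) (chartAt (Cn n) p p)

/-- The linear rank of `G` is at least `r`: at every singular point `p`, the rank of the
derivative at (the chart image of) `p` of the defining vector field is at least `r`. -/
def MLinRankGE (G : MFol1 n M) (r : ℕ) : Prop :=
  ∀ p ∈ MFol1.sing G, r ≤ rkAt (G.V p) (chartAt (Cn n) p p)

/-- The stalk of the tangent sheaf of `D` at `p` is a free module with `r` generators. -/
def MStalkFreeWith (D : MDist n k M) (p : M) (r : ℕ) : Prop :=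
  ∃ Xs : Fin r → VF n, (∀ i, AnalyticAt ℂ (Xs i) (chartAt (Cn n) p p)) ∧
    (∀ i, ∀ᶠ z in 𝓝 (chartAt (Cn n) p p), TangentAt (D.ω p) (Xs i) z) ∧
    FreeGensAt (D.ω p) Xs (chartAt (Cn n) p p)

/-- (a) The tangent sheaf of `D` is locally free of rank `k`: near every point there are
`k` holomorphic tangent vector fields which freely generate every stalk. -/
def MPropA (D : MDist n k M) : Prop :=
  ∀ p : M, ∃ U : Set (Cn n), IsOpen U ∧ chartAt (Cn n) p p ∈ U ∧ U ⊆ D.dom p ∧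
    ∃ Xs : Fin k → VF n, (∀ i, AnalyticOnNhd ℂ (Xs i) U) ∧
      (∀ i, ∀ z ∈ U, TangentAt (D.ω p) (Xs i) z) ∧
      ∀ z ∈ U, FreeGensAt (D.ω p) Xs z

/-- (b) Near every point, `T_D` is the direct sum of the tangent sheaves of `k`
one-dimensional foliations (defined by vector fields with singular set of codim `≥ 2`). -/
def MPropB (D : MDist n k M) : Prop :=
  ∀ p : M, ∃ U : Set (Cn n), IsOpen U ∧ chartAt (Cn n) p p ∈ U ∧ U ⊆ D.dom p ∧
    ∃ Xs : Fin k → VF n, (∀ i, AnalyticOnNhd ℂ (Xs i) U) ∧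
      (∀ i, CodimGE n {z ∈ U | Xs i z = 0} 2) ∧
      (∀ i, ∀ z ∈ U, TangentAt (D.ω p) (Xs i) z) ∧
      ∀ z ∈ U, FreeGensAt (D.ω p) Xs z

/-- (c) Near every point, a form `i_{X_1} ⋯ i_{X_k} Θ` defines `D`. -/
def MPropC (h : n = k + (n - k)) (D : MDist n k M) : Prop :=
  ∀ p : M, ∃ U : Set (Cn n), IsOpen U ∧ chartAt (Cn n) p p ∈ U ∧ U ⊆ D.dom p ∧
    ∃ (Xs : Fin k → VF n) (Θ : Form n n) (u : Cn n → ℂ),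
      (∀ i, AnalyticOnNhd ℂ (Xs i) U) ∧ HolFormOn U Θ ∧
      AnalyticOnNhd ℂ u U ∧ (∀ z ∈ U, u z ≠ 0) ∧
      ∀ z ∈ U, ∀ v : Fin (n - k) → Cn n,
        D.ω p z v = u z * Θ z (fun i => Fin.append (fun a => Xs a z) v (Fin.cast h i))

/-- (d) At every point, a form `i_{X_1} ⋯ i_{X_k} Θ` defines the germ of `D`. -/
def MPropD (h : n = k + (n - k)) (D : MDist n k M) : Prop :=
  ∀ p : M, ∃ (Xs : Fin k → VF n) (Θ : Form n n) (u : Cn n → ℂ),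
    (∀ i, AnalyticAt ℂ (Xs i) (chartAt (Cn n) p p)) ∧ HolFormAt (chartAt (Cn n) p p) Θ ∧
    AnalyticAt ℂ u (chartAt (Cn n) p p) ∧ u (chartAt (Cn n) p p) ≠ 0 ∧
    ∀ᶠ z in 𝓝 (chartAt (Cn n) p p), ∀ v : Fin (n - k) → Cn n,
      D.ω p z v = u z * Θ z (fun i => Fin.append (fun a => Xs a z) v (Fin.cast h i))

/-- (e) Every stalk of `T_D` is a free module with `k` generators. -/
def MPropE (D : MDist n k M) : Prop :=
  ∀ p : M, MStalkFreeWith D p k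

/-- A subset `S` of the complex manifold `M` is analytic: it is closed and locally,
in charts, the common zero set of finitely many holomorphic functions. -/
def MIsAnalytic (n : ℕ) {M : Type*} [TopologicalSpace M] [ChartedSpace (Cn n) M] (S : Set M) : Prop :=
  IsClosed S ∧ ∀ p : M, ∃ W ∈ 𝓝 (chartAt (Cn n) p p), ∃ (r : ℕ) (f : Fin r → Cn n → ℂ),
    (∀ i, AnalyticOnNhd ℂ (f i) W) ∧
    ∀ z ∈ W ∩ (chartAt (Cn n) p).target, ((chartAt (Cn n) p).symm z ∈ S ↔ ∀ i, f i z = 0)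

/-- Irreducible analytic subsets of `M`. -/
def MIrredAnalytic (n : ℕ) {M : Type*} [TopologicalSpace M] [ChartedSpace (Cn n) M] (S : Set M) : Prop :=
  MIsAnalytic n S ∧ S.Nonempty ∧
    ∀ S1 S2 : Set M, MIsAnalytic n S1 → MIsAnalytic n S2 → S = S1 ∪ S2 → S = S1 ∨ S = S2

/-- `C` is an irreducible component of `V ⊆ M`. -/
def MIrredComponentOf (n : ℕ) {M : Type*} [TopologicalSpace M] [ChartedSpace (Cn n) M] (V C : Set M) : Prop :=
  MIrredAnalytic n C ∧ C ⊆ V ∧ ∀ C', MIrredAnalytic n C' → C ⊆ C' → C' ⊆ V → C' = C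

/-- The local dimension of `S ⊆ M` at `p` equals `d` (via Hausdorff dimension of chart
images on small neighborhoods). -/
def MLocDimEq (n : ℕ) {M : Type*} [TopologicalSpace M] [ChartedSpace (Cn n) M] (S : Set M) (p : M) (d : ℕ) : Prop :=
  ∀ᶠ U in (𝓝 p).smallSets,
    dimH (chartAt (Cn n) p '' (S ∩ U ∩ (chartAt (Cn n) p).source)) = ((2 * d : ℕ) : ℝ≥0∞)

/-- The dimension of `S ⊆ M` equals `d`. -/
def MDimEq (n : ℕ) {M : Type*} [TopologicalSpace M] [ChartedSpace (Cn n) M] (S : Set M) (d : ℕ) : Prop :=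
  (∀ p : M, ∀ᶠ U in (𝓝 p).smallSets,
    dimH (chartAt (Cn n) p '' (S ∩ U ∩ (chartAt (Cn n) p).source)) ≤ ((2 * d : ℕ) : ℝ≥0∞)) ∧
  ∃ p : M, MLocDimEq n S p d

end Manifold

end


section Had
variable {E : Type*} [NormedAddCommGroup E] [NormedSpace ℂ E]

lemma had_step (N : ℕ) (p : ContinuousMultilinearMap ℂ (fun _ : Fin (N + 1) => E) ℂ)
    (m : E →L[ℂ] ℂ) (b z : E) (P : E →L[ℂ] E) (hP : ∀ z, P z = z - m z • b) (a : Fin (N + 1)) :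
    m z * p (a.insertNth b (fun j : Fin N => if j.castSucc < a then P z else z)) =
      p (fun j => if (j : ℕ) < a then P z else z) -
      p (fun j => if (j : ℕ) < a + 1 then P z else z) := by
  set c : Fin (N + 1) → E := fun j => if (j : ℕ) < a then P z else z with hc
  have h1 : c = Function.update c a z := by
    rw [eq_comm, Function.update_eq_self_iff]; simp [hc]
  have h2 : (fun j : Fin (N + 1) => if (j : ℕ) < a + 1 then P z else z)
      = Function.update c a (P z) := by
    funext j
    by_cases h : j = a
    · subst h; simp
    · have : (j : ℕ) ≠ a := fun h' => h (Fin.ext h')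
      simp only [Function.update_of_ne h, hc]
      congr 1
      simp only [eq_iff_iff]; omega
  have h3 : (a.insertNth b (fun j : Fin N => if j.castSucc < a then P z else z) : Fin (N + 1) → E)
      = Function.update c a b := by
    rw [Fin.insertNth_eq_iff]
    refine ⟨by simp, ?_⟩
    funext j
    simp only [Fin.removeNth_apply, Function.update_of_ne (Fin.succAbove_ne a j), hc]
    congr 1
    simp only [eq_iff_iff, Fin.succAbove]
    split_ifs with h
    · simp [Fin.lt_def] at h ⊢
    · simp only [Fin.lt_def, Fin.val_castSucc, Fin.val_succ] at h ⊢; omega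
  rw [h2, h3]
  conv_rhs => rw [h1]
  rw [Function.update_idem, ← p.map_update_sub, hP]
  simp [p.map_update_smul]

lemma had_tele (N : ℕ) (p : ContinuousMultilinearMap ℂ (fun _ : Fin (N + 1) => E) ℂ)
    (m : E →L[ℂ] ℂ) (b z : E) (P : E →L[ℂ] E) (hP : ∀ z, P z = z - m z • b) :
    m z * ∑ a : Fin (N + 1),
      p (a.insertNth b (fun j : Fin N => if j.castSucc < a then P z else z)) =
      p (fun _ => z) - p (fun _ => P z) := by
  let D : ℕ → ℂ := fun i => p (fun j : Fin (N + 1) => if (j : ℕ) < i then P z else z)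
  have e : ∀ a : Fin (N + 1),
      m z * p (a.insertNth b (fun j : Fin N => if j.castSucc < a then P z else z)) =
        D a - D (a + 1) := fun a => had_step N p m b z P hP a
  rw [Finset.mul_sum, Finset.sum_congr rfl (fun a _ => e a),
    Fin.sum_univ_eq_sum_range (fun i => D i - D (i + 1)) (N + 1), Finset.sum_range_sub']
  simp only [D, Nat.not_lt_zero, if_false, Fin.is_lt, if_true]

lemma hadamard (f : E → ℂ) (hf : AnalyticAt ℂ f 0) (m : E →L[ℂ] ℂ) (b : E) :
    ∃ h : E → ℂ, AnalyticAt ℂ h 0 ∧ ∀ᶠ z in 𝓝 (0 : E), f z = f (z - m z • b) + m z * h z := by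
  obtain ⟨p, hp⟩ := hf
  set P : E →L[ℂ] E := ContinuousLinearMap.id ℂ E - m.smulRight b with hPdef
  have hP : ∀ z, P z = z - m z • b := fun z => by simp [hPdef]
  let T : (N : ℕ) → (a : Fin (N + 1)) → ContinuousMultilinearMap ℂ (fun _ : Fin N => E) ℂ :=
    fun N a => ((p (N + 1)).curryMid a b).compContinuousLinearMap
      (fun j => if j.castSucc < a then P else ContinuousLinearMap.id ℂ E)
  let q : FormalMultilinearSeries ℂ E ℂ := fun N => ∑ a : Fin (N + 1), T N a
  have hq : ∀ N z, m z * q N (fun _ => z) = p (N + 1) (fun _ => z) - p (N + 1) (fun _ => P z) := by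
    intro N z
    rw [← had_tele N (p (N + 1)) m b z P hP]
    simp only [q, _root_.sum_apply]
    congr 1
    refine Finset.sum_congr rfl (fun a _ => ?_)
    simp only [T, ContinuousMultilinearMap.compContinuousLinearMap_apply,
      ContinuousMultilinearMap.curryMid_apply]
    congr 2
    funext j
    split_ifs <;> rfl
  obtain ⟨C, r, hC, hr, hb⟩ := p.le_mul_pow_of_radius_pos hp.radius_pos
  set K : ℝ := max 1 ‖P‖ with hK
  have hK1 : 1 ≤ K := le_max_left _ _
  have hT : ∀ N a, ‖T N a‖ ≤ C * r ^ (N + 1) * ‖b‖ * K ^ N := by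
    intro N a
    refine (ContinuousMultilinearMap.norm_compContinuousLinearMap_le _ _).trans ?_
    have h1 : ‖(p (N + 1)).curryMid a b‖ ≤ C * r ^ (N + 1) * ‖b‖ := by
      refine (ContinuousLinearMap.le_opNorm _ _).trans ?_
      rw [ContinuousMultilinearMap.norm_curryMid]
      gcongr
      exact hb _
    have h2 : ∏ j : Fin N, ‖(if j.castSucc < a then P else ContinuousLinearMap.id ℂ E)‖ ≤ K ^ N := by
      refine (Finset.prod_le_prod (g := fun _ => K) (fun _ _ => norm_nonneg _) ?_).trans (by simp)
      intro j _
      split_ifs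
      · exact le_max_right _ _
      · exact ContinuousLinearMap.norm_id_le.trans hK1
    exact mul_le_mul h1 h2 (Finset.prod_nonneg fun _ _ => norm_nonneg _) (by positivity)
  have hqn : ∀ N, ‖q N‖ ≤ C * r * ‖b‖ * (2 * r * K) ^ N := by
    intro N
    calc ‖q N‖ ≤ ∑ a : Fin (N + 1), C * r ^ (N + 1) * ‖b‖ * K ^ N :=
          norm_sum_le_of_le _ (fun a _ => hT N a)
      _ = (N + 1 : ℝ) * (C * r ^ (N + 1) * ‖b‖ * K ^ N) := by simp
      _ ≤ (2 : ℝ) ^ N * (C * r ^ (N + 1) * ‖b‖ * K ^ N) := by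
          gcongr
          exact_mod_cast Nat.lt_two_pow_self (n := N)
      _ = _ := by ring
  have hrad : 0 < q.radius := by
    have hpos : 0 < 2 * r * K := by positivity
    have : (((2 * r * K)⁻¹.toNNReal : NNReal) : ENNReal) ≤ q.radius := by
      refine q.le_radius_of_bound (C * r * ‖b‖) (fun N => ?_)
      rw [Real.coe_toNNReal _ (by positivity)]
      calc ‖q N‖ * ((2 * r * K)⁻¹) ^ N ≤ (C * r * ‖b‖ * (2 * r * K) ^ N) * ((2 * r * K)⁻¹) ^ N := by
            gcongr; exact hqn N
        _ = C * r * ‖b‖ := by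
            rw [inv_pow]; field_simp
    refine lt_of_lt_of_le ?_ this
    simp only [ENNReal.coe_pos, Real.toNNReal_pos]
    positivity
  have hqs := q.hasFPowerSeriesOnBall hrad
  refine ⟨q.sum, hqs.analyticAt, ?_⟩
  have c1 : ∀ᶠ z in 𝓝 (0 : E), HasSum (fun n => p n (fun _ => z)) (f z) := by
    have := hp.eventually_hasSum
    simpa using this
  have c2 : ∀ᶠ z in 𝓝 (0 : E), HasSum (fun n => p n (fun _ => P z)) (f (P z)) := by
    have ht : Tendsto P (𝓝 0) (𝓝 0) := by simpa using P.continuous.tendsto 0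
    exact ht.eventually c1
  have c3 : ∀ᶠ z in 𝓝 (0 : E), HasSum (fun n => q n (fun _ => z)) (q.sum z) := by
    have := hqs.hasFPowerSeriesAt.eventually_hasSum
    simpa using this
  filter_upwards [c1, c2, c3] with z h1 h2 h3
  have h4 := h3.mul_left (m z)
  simp only [hq] at h4
  have h5 := (hasSum_nat_add_iff' 1).2 (h1.sub h2)
  have h6 := h5.unique h4
  have : p 0 (fun _ => z) = p 0 (fun _ => P z) := by
    congr 1; funext i; exact i.elim0
  simp [this] at h6
  rw [← hP, ← h6]; ring

/-- Linear independence data: dual system. -/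
def DualSys (q : ℕ) (m : ℕ → E →L[ℂ] ℂ) (b : ℕ → E) : Prop :=
  ∀ l < q, ∀ l' < q, m l (b l') = if l = l' then 1 else 0

/-- The projection killing the first `i` coordinates. -/
noncomputable def projQ (m : ℕ → E →L[ℂ] ℂ) (b : ℕ → E) (i : ℕ) : E →L[ℂ] E :=
  ContinuousLinearMap.id ℂ E - ∑ l ∈ Finset.range i, (m l).smulRight (b l)

lemma projQ_apply (m : ℕ → E →L[ℂ] ℂ) (b : ℕ → E) (i : ℕ) (z : E) :
    projQ m b i z = z - ∑ l ∈ Finset.range i, m l z • b l := by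
  simp [projQ]

lemma projQ_b {q : ℕ} {m : ℕ → E →L[ℂ] ℂ} {b : ℕ → E} (h : DualSys q m b) {i : ℕ} (hi : i < q) :
    projQ m b i (b i) = b i := by
  rw [projQ_apply, Finset.sum_eq_zero, sub_zero]
  intro l hl
  have hl := Finset.mem_range.1 hl
  rw [h l (hl.trans hi) i hi, if_neg hl.ne, zero_smul]

lemma m_projQ {q : ℕ} {m : ℕ → E →L[ℂ] ℂ} {b : ℕ → E} (h : DualSys q m b) {i : ℕ} (hi : i < q)
    {j : ℕ} (hj : j < q) (z : E) : m j (projQ m b i z) = if j < i then 0 else m j z := by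
  rw [projQ_apply, map_sub, map_sum]
  have : ∀ l ∈ Finset.range i, m j (m l z • b l) = if j = l then m j z else 0 := by
    intro l hl
    have hl := Finset.mem_range.1 hl
    rw [map_smul, h j hj l (hl.trans hi)]
    split_ifs with e
    · simp [e]
    · simp
  rw [Finset.sum_congr rfl this, Finset.sum_ite_eq]
  simp only [Finset.mem_range]
  split_ifs <;> simp

lemma hadamard_iter {q : ℕ} {m : ℕ → E →L[ℂ] ℂ} {b : ℕ → E} (hd : DualSys q m b)
    (f : E → ℂ) (hf : AnalyticAt ℂ f 0) (i : ℕ) (hi : i < q) :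
    ∃ h : ℕ → E → ℂ, (∀ l, AnalyticAt ℂ (h l) 0) ∧ ∀ᶠ z in 𝓝 (0 : E),
      f z = f (projQ m b i z) + ∑ l ∈ Finset.range i, m l z * h l z := by
  induction i with
  | zero => exact ⟨fun _ _ => 0, fun _ => analyticAt_const, by simp [projQ]⟩
  | succ i ih =>
    have hi' : i < q := by omega
    obtain ⟨h, hh, he⟩ := ih hi'
    have hF : AnalyticAt ℂ (fun z => f (projQ m b i z)) 0 :=
      AnalyticAt.fun_comp (by simpa using hf) ((projQ m b i).analyticAt 0)
    obtain ⟨k, hk, hke⟩ := hadamard _ hF (m i) (b i)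
    refine ⟨Function.update h i k, fun l => ?_, ?_⟩
    · by_cases e : l = i
      · subst e; simpa using hk
      · simpa [Function.update_of_ne e] using hh l
    · filter_upwards [he, hke] with z h1 h2
      rw [Finset.sum_range_succ, h1, h2]
      have e1 : projQ m b i (z - m i z • b i) = projQ m b (i + 1) z := by
        rw [map_sub, map_smul, projQ_b hd hi', projQ_apply, projQ_apply, Finset.sum_range_succ]
        abel
      have e2 : ∑ l ∈ Finset.range i, m l z * Function.update h i k l z =
          ∑ l ∈ Finset.range i, m l z * h l z := by
        refine Finset.sum_congr rfl fun l hl => ?_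
        rw [Function.update_of_ne (Finset.mem_range.1 hl).ne]
      rw [e1, e2]
      simp only [Function.update_self]
      ring

lemma zero_of_mul (m : E →L[ℂ] ℂ) (b : E) (hmb : m b ≠ 0) (F : E → ℂ) (hF : AnalyticAt ℂ F 0)
    (h : ∀ᶠ z in 𝓝 (0 : E), m z * F z = 0) : ∀ᶠ z in 𝓝 (0 : E), F z = 0 := by
  filter_upwards [h.eventually_nhds, hF.eventually_analyticAt] with z h1 h2
  by_cases hm : m z = 0
  · have hc : ContinuousAt (fun t : ℂ => F (z + t • b)) 0 := by
      refine ContinuousAt.comp (g := F) (by simpa using h2.continuousAt) (by fun_prop)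
    have hc' : Tendsto (fun t : ℂ => F (z + t • b)) (𝓝[≠] 0) (𝓝 (F z)) := by
      simpa using hc.tendsto.mono_left nhdsWithin_le_nhds
    have ht : Tendsto (fun t : ℂ => z + t • b) (𝓝[≠] 0) (𝓝 z) := by
      have : ContinuousAt (fun t : ℂ => z + t • b) 0 := by fun_prop
      simpa using this.tendsto.mono_left nhdsWithin_le_nhds
    have hz : ∀ᶠ t in 𝓝[≠] (0 : ℂ), F (z + t • b) = 0 := by
      filter_upwards [ht.eventually h1, self_mem_nhdsWithin] with t ht htne
      have htne : t ≠ 0 := htne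
      have : m (z + t • b) ≠ 0 := by simp [hm, htne, hmb]
      exact (mul_eq_zero.1 ht).resolve_left this
    exact tendsto_nhds_unique hc' (tendsto_const_nhds.congr' (hz.mono fun _ h => h.symm))
  · exact (mul_eq_zero.1 h1.self_of_nhds).resolve_left hm

lemma reg_lin {q : ℕ} {m : ℕ → E →L[ℂ] ℂ} {b : ℕ → E} (hd : DualSys q m b)
    (f : E → ℂ) (hf : AnalyticAt ℂ f 0) (i : ℕ) (hi : i < q) (g : ℕ → E → ℂ)
    (h : ∀ᶠ z in 𝓝 (0 : E), m i z * f z = ∑ l ∈ Finset.range i, m l z * g l z) :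
    ∃ h : ℕ → E → ℂ, (∀ l, AnalyticAt ℂ (h l) 0) ∧ ∀ᶠ z in 𝓝 (0 : E),
      f z = ∑ l ∈ Finset.range i, m l z * h l z := by
  obtain ⟨k, hk, hke⟩ := hadamard_iter hd f hf i hi
  refine ⟨k, hk, ?_⟩
  have hF : AnalyticAt ℂ (fun z => f (projQ m b i z)) 0 :=
    AnalyticAt.fun_comp (by simpa using hf) ((projQ m b i).analyticAt 0)
  have ht : Tendsto (projQ m b i) (𝓝 0) (𝓝 0) := by
    simpa using (projQ m b i).continuous.tendsto 0
  have hz : ∀ᶠ z in 𝓝 (0 : E), f (projQ m b i z) = 0 := by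
    refine zero_of_mul (m i) (b i) (by simp [hd i hi i hi]) _ hF ?_
    filter_upwards [ht.eventually h] with z hz
    rw [m_projQ hd hi hi, if_neg (lt_irrefl i)] at hz
    rw [hz]
    refine Finset.sum_eq_zero fun l hl => ?_
    have hl := Finset.mem_range.1 hl
    rw [m_projQ hd hi (hl.trans hi), if_pos hl, zero_mul]
  filter_upwards [hke, hz] with z h1 h2
  rw [h1, h2, zero_add]

/-- Regular sequence of analytic germs. -/
def RegSeq (q : ℕ) (a : ℕ → E → ℂ) : Prop :=
  ∀ i < q, ∀ (f : E → ℂ), AnalyticAt ℂ f 0 → ∀ g : ℕ → E → ℂ, (∀ l, AnalyticAt ℂ (g l) 0) →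
    (∀ᶠ z in 𝓝 (0 : E), a i z * f z = ∑ l ∈ Finset.range i, a l z * g l z) →
    ∃ h : ℕ → E → ℂ, (∀ l, AnalyticAt ℂ (h l) 0) ∧ ∀ᶠ z in 𝓝 (0 : E),
      f z = ∑ l ∈ Finset.range i, a l z * h l z

lemma regSeq_of [CompleteSpace E] {q : ℕ} {m : ℕ → E →L[ℂ] ℂ} {b : ℕ → E} (hd : DualSys q m b)
    (a : ℕ → E → ℂ) (ha : ∀ l, AnalyticAt ℂ (a l) 0) (ha0 : ∀ l, a l 0 = 0)
    (hda : ∀ l < q, fderiv ℂ (a l) 0 = m l) : RegSeq q a := by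
  let φ : E → E := fun z => z + ∑ l ∈ Finset.range q, (a l z - m l z) • b l
  have hφ : AnalyticAt ℂ φ 0 := by
    refine analyticAt_id.add (Finset.analyticAt_fun_sum _ fun l _ => ?_)
    exact ((ha l).sub ((m l).analyticAt 0)).smul analyticAt_const
  have hφ0 : φ 0 = 0 := by simp [φ, ha0]
  have hφ' : HasFDerivAt φ (ContinuousLinearMap.id ℂ E) 0 := by
    have h1 : HasFDerivAt φ (ContinuousLinearMap.id ℂ E +
        ∑ l ∈ Finset.range q, (m l - m l).smulRight (b l)) 0 := by
      refine (hasFDerivAt_id _).add (HasFDerivAt.fun_sum fun l hl => ?_)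
      refine HasFDerivAt.smul_const (HasFDerivAt.sub ?_ (m l).hasFDerivAt) _
      rw [← hda l (Finset.mem_range.1 hl)]
      exact (ha l).differentiableAt.hasFDerivAt
    simpa using h1
  have hs : HasStrictFDerivAt φ ((ContinuousLinearEquiv.refl ℂ E : E ≃L[ℂ] E) : E →L[ℂ] E) 0 := by
    have := hφ.hasStrictFDerivAt
    rw [hφ'.fderiv] at this
    exact this
  let Φ := hs.toOpenPartialHomeomorph φ
  have hΦ : ∀ z, Φ z = φ z := fun z => rfl
  have h0s : (0 : E) ∈ Φ.source := hs.mem_toOpenPartialHomeomorph_source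
  let ψ : E → E := Φ.symm
  have hψ : AnalyticAt ℂ ψ 0 := by
    have := Φ.analyticAt_symm' (i := ContinuousLinearEquiv.refl ℂ E) h0s hφ hφ'.fderiv
    rwa [hΦ, hφ0] at this
  have hψφ : ∀ᶠ z in 𝓝 (0 : E), ψ (φ z) = z := Φ.eventually_left_inverse h0s
  have hφψ : ∀ᶠ z in 𝓝 (0 : E), φ (ψ z) = z := by
    have := Φ.eventually_right_inverse (x := 0) (by simpa [hΦ, hφ0] using Φ.map_source h0s)
    exact this
  have hψ0 : ψ 0 = 0 := by
    have := hψφ.self_of_nhds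
    rwa [hφ0] at this
  have hmφ : ∀ l < q, ∀ z, m l (φ z) = a l z := by
    intro l hl z
    simp only [φ, map_add, map_sum, map_smul]
    have : ∀ l' ∈ Finset.range q, (a l' z - m l' z) • m l (b l') =
        if l = l' then a l z - m l z else 0 := by
      intro l' hl'
      rw [hd l hl l' (Finset.mem_range.1 hl')]
      split_ifs with e
      · simp [e]
      · simp
    rw [Finset.sum_congr rfl this, Finset.sum_ite_eq, if_pos (Finset.mem_range.2 hl)]
    ring
  have haψ : ∀ᶠ z in 𝓝 (0 : E), ∀ l < q, a l (ψ z) = m l z := by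
    filter_upwards [hφψ] with z hz l hl
    rw [← hmφ l hl, hz]
  have tφ : Tendsto φ (𝓝 0) (𝓝 0) := by simpa [hφ0] using hφ.continuousAt.tendsto
  have tψ : Tendsto ψ (𝓝 0) (𝓝 0) := by simpa [hψ0] using hψ.continuousAt.tendsto
  intro i hi f hf g hg h
  obtain ⟨k, hk, hke⟩ := reg_lin hd (fun z => f (ψ z))
    (AnalyticAt.fun_comp (by rwa [hψ0]) hψ) i hi (fun l z => g l (ψ z)) (by
      filter_upwards [tψ.eventually h, haψ] with z h1 h2
      rw [← h2 i hi, h1]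
      refine Finset.sum_congr rfl fun l hl => ?_
      rw [h2 l ((Finset.mem_range.1 hl).trans hi)])
  refine ⟨fun l z => k l (φ z), fun l => AnalyticAt.fun_comp (by rw [hφ0]; exact hk l) hφ, ?_⟩
  filter_upwards [tφ.eventually hke, hψφ] with z h1 h2
  rw [h2] at h1
  rw [h1]
  refine Finset.sum_congr rfl fun l hl => ?_
  rw [hmφ l ((Finset.mem_range.1 hl).trans hi)]

end Had

section Forms

/-- Wedge with a fixed `1`-covector, as an alternating map. -/
noncomputable def wed {n k : ℕ} (w : AlternatingMap ℂ (Cn n) ℂ (Fin 1)) :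
    AlternatingMap ℂ (Cn n) ℂ (Fin k) →ₗ[ℂ] AlternatingMap ℂ (Cn n) ℂ (Fin (k + 1)) where
  toFun α := AlternatingMap.alternatizeUncurryFin
    (LinearMap.smulRight (AlternatingMap.ofSubsingleton ℂ (Cn n) ℂ (0 : Fin 1) |>.symm w) α)
  map_add' α β := by
    ext v
    simp [AlternatingMap.alternatizeUncurryFin_apply, Finset.sum_add_distrib, mul_add, smul_add]
  map_smul' c α := by
    ext v
    simp [AlternatingMap.alternatizeUncurryFin_apply, Finset.mul_sum]
    refine Finset.sum_congr rfl fun i _ => ?_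
    ring

lemma wed_apply {n k : ℕ} (w : AlternatingMap ℂ (Cn n) ℂ (Fin 1))
    (α : AlternatingMap ℂ (Cn n) ℂ (Fin k)) (v : Fin (k + 1) → Cn n) :
    wed w α v = ∑ i : Fin (k + 1), (-1 : ℂ) ^ (i : ℕ) * w (fun _ => v i) *
      α (fun j => v (i.succAbove j)) := by
  simp only [wed, LinearMap.coe_mk, AddHom.coe_mk, AlternatingMap.alternatizeUncurryFin_apply]
  refine Finset.sum_congr rfl fun i _ => ?_
  have : i.removeNth v = fun j => v (i.succAbove j) := rfl
  simp [this, mul_assoc]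

lemma wedge1_eq {n k : ℕ} (ω : Form n 1) (α : Form n k) (z : Cn n) (v : Fin (k + 1) → Cn n) :
    wedge1 ω α z v = wed (ω z) (α z) v := by
  rw [wed_apply]; rfl

lemma wed_wed {n k : ℕ} (w : AlternatingMap ℂ (Cn n) ℂ (Fin 1))
    (α : AlternatingMap ℂ (Cn n) ℂ (Fin k)) : wed w (wed w α) = 0 := by
  set u := (AlternatingMap.ofSubsingleton ℂ (Cn n) ℂ (0 : Fin 1) |>.symm w) with hu
  have := AlternatingMap.alternatizeUncurryFin_alternatizeUncurryFinLM_comp_of_symmetric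
    (f := LinearMap.smulRight u (LinearMap.smulRight u α)) (by
      intro x y; ext v; simp; ring)
  rw [← this]
  change AlternatingMap.alternatizeUncurryFin _ = _
  congr 1
  ext x v
  simp [wed, ← hu, AlternatingMap.alternatizeUncurryFin_apply, Finset.mul_sum]

/-- Contraction formula. -/
lemma wed_cons {n k : ℕ} (w : AlternatingMap ℂ (Cn n) ℂ (Fin 1))
    (α : AlternatingMap ℂ (Cn n) ℂ (Fin (k + 1))) (e : Cn n) :
    (wed w α).curryLeft e = w (fun _ => e) • α - wed w (α.curryLeft e) := by
  ext v
  simp only [AlternatingMap.curryLeft_apply_apply, AlternatingMap.sub_apply,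
    AlternatingMap.smul_apply, wed_apply, Matrix.vecCons]
  rw [Fin.sum_univ_succ, sub_eq_add_neg, ← Finset.sum_neg_distrib]
  congr 1
  · simp
  · refine Finset.sum_congr rfl fun i _ => ?_
    have : (fun j : Fin (k + 1) => (Fin.cons e v : Fin (k + 2) → Cn n) (i.succ.succAbove j)) =
        Fin.cons e (fun j => v (i.succAbove j)) := by
      funext j
      refine Fin.cases ?_ (fun j => ?_) j
      · simp
      · simp
    rw [this]
    simp [pow_succ]

lemma wed_cons_zero {n : ℕ} (w : AlternatingMap ℂ (Cn n) ℂ (Fin 1))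
    (α : AlternatingMap ℂ (Cn n) ℂ (Fin 0)) (e : Cn n) :
    (wed w α).curryLeft e = w (fun _ => e) • α := by
  ext v
  simp only [AlternatingMap.curryLeft_apply_apply,
    AlternatingMap.smul_apply, wed_apply, Matrix.vecCons]
  simp

lemma curry_sum {n k : ℕ} (i : ℕ) (a : ℕ → ℂ)
    (g : ℕ → AlternatingMap ℂ (Cn n) ℂ (Fin (k + 1))) (e : Cn n) :
    (∑ l ∈ Finset.range i, a l • g l).curryLeft e =
      ∑ l ∈ Finset.range i, a l • (g l).curryLeft e := by
  induction i with
  | zero => simp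
  | succ i ih => simp [Finset.sum_range_succ, ih]

lemma hol_wed {n k : ℕ} {ω : Form n 1} {α : Form n k} (hω : HolFormAt 0 ω) (hα : HolFormAt 0 α) :
    HolFormAt 0 (fun z => wed (ω z) (α z)) := by
  intro v
  simp only [wed_apply]
  exact Finset.analyticAt_fun_sum _ fun i _ => (analyticAt_const.mul (hω _)).mul (hα _)

lemma hol_curry {n k : ℕ} {α : Form n (k + 1)} (hα : HolFormAt 0 α) (e : Cn n) :
    HolFormAt 0 (fun z => (α z).curryLeft e) := fun v => hα _

lemma hol_add {n k : ℕ} {α β : Form n k} (hα : HolFormAt 0 α) (hβ : HolFormAt 0 β) :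
    HolFormAt 0 (fun z => α z + β z) := fun v => (hα v).add (hβ v)

lemma hol_sub {n k : ℕ} {α β : Form n k} (hα : HolFormAt 0 α) (hβ : HolFormAt 0 β) :
    HolFormAt 0 (fun z => α z - β z) := fun v => (hα v).sub (hβ v)

lemma hol_neg {n k : ℕ} {α : Form n k} (hα : HolFormAt 0 α) :
    HolFormAt 0 (fun z => - α z) := fun v => (hα v).neg

/-- Regularity for forms. -/
lemma regForm {n q k : ℕ} {a : ℕ → Cn n → ℂ} (hr : RegSeq q a) (i : ℕ) (hi : i < q)
    (η : Form n k) (hη : HolFormAt 0 η) (g : ℕ → Form n k) (hg : ∀ l, HolFormAt 0 (g l))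
    (h : ∀ᶠ z in 𝓝 (0 : Cn n), a i z • η z = ∑ l ∈ Finset.range i, a l z • g l z) :
    ∃ h : ℕ → Form n k, (∀ l, HolFormAt 0 (h l)) ∧ ∀ᶠ z in 𝓝 (0 : Cn n),
      η z = ∑ l ∈ Finset.range i, a l z • h l z := by
  let ev : AlternatingMap ℂ (Cn n) ℂ (Fin k) →ₗ[ℂ] ((Fin k → Fin n) → ℂ) :=
    { toFun := fun α I => α (fun j => Pi.single (I j) 1)
      map_add' := fun _ _ => rfl
      map_smul' := fun _ _ => rfl }
  have hev : Function.Injective ev := by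
    intro α β hab
    refine AlternatingMap.coe_multilinearMap_injective
      (Module.Basis.ext_multilinear (fun _ => Pi.basisFun ℂ (Fin n)) fun I => ?_)
    have := congrFun hab I
    simpa [ev] using this
  obtain ⟨L, hL⟩ := LinearMap.exists_leftInverse_of_injective ev (LinearMap.ker_eq_bot.2 hev)
  have key : ∀ I : Fin k → Fin n, ∃ h : ℕ → Cn n → ℂ, (∀ l, AnalyticAt ℂ (h l) 0) ∧
      ∀ᶠ z in 𝓝 (0 : Cn n), ev (η z) I = ∑ l ∈ Finset.range i, a l z * h l z := by
    intro I
    refine hr i hi (fun z => ev (η z) I) (hη _) (fun l z => ev (g l z) I) (fun l => hg l _) ?_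
    filter_upwards [h] with z hz
    have := congrFun (congrArg ev hz) I
    simpa using this
  choose c hc hce using key
  refine ⟨fun l z => L (fun I => c I l z), fun l v => ?_, ?_⟩
  · let ℓ : ((Fin k → Fin n) → ℂ) →ₗ[ℂ] ℂ :=
      { toFun := fun x => L x v
        map_add' := fun x y => by simp
        map_smul' := fun x y => by simp }
    have h1 : AnalyticAt ℂ (fun z => fun I => c I l z) (0 : Cn n) :=
      AnalyticAt.pi fun I => hc I l
    exact (ℓ.toContinuousLinearMap.analyticAt _).fun_comp h1
  · filter_upwards [eventually_all.2 hce] with z hz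
    have h2 : η z = L (ev (η z)) := by
      rw [← LinearMap.comp_apply, hL]; rfl
    have h3 : ev (η z) = ∑ l ∈ Finset.range i, a l z • (fun I => c I l z) := by
      funext I
      simp [hz I]
    rw [h2, h3]
    simp

/-- Exactness for the complex given by wedge with `ω`. -/
def ExactF {n : ℕ} (ω : Form n 1) : (k : ℕ) → Form n k → Prop
  | 0, δ => ∀ᶠ z in 𝓝 (0 : Cn n), δ z = 0
  | k + 1, δ => ∃ β : Form n k, HolFormAt 0 β ∧ ∀ᶠ z in 𝓝 (0 : Cn n), δ z = wed (ω z) (β z)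

lemma ExactF.closed {n : ℕ} {ω : Form n 1} {k : ℕ} {δ : Form n k} (h : ExactF ω k δ) :
    ∀ᶠ z in 𝓝 (0 : Cn n), wed (ω z) (δ z) = 0 := by
  cases k with
  | zero => exact Filter.Eventually.mono h fun z hz => by rw [hz, map_zero]
  | succ k =>
    obtain ⟨β, -, h⟩ := h
    exact h.mono fun z hz => by rw [hz, wed_wed]

lemma claim {n q : ℕ} {ω : Form n 1} (hω : HolFormAt 0 ω) (c : ℕ → Cn n)
    (hr : RegSeq q (fun l z => ω z (fun _ => c l))) (k : ℕ) :
    ∀ i, i + k < q → ∀ α : Form n k, HolFormAt 0 α → ∀ g : ℕ → Form n (k + 1),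
      (∀ l, HolFormAt 0 (g l)) →
      (∀ᶠ z in 𝓝 (0 : Cn n), wed (ω z) (α z) =
        ∑ l ∈ Finset.range i, ω z (fun _ => c l) • g l z) →
      ∃ δ : Form n k, ExactF ω k δ ∧ ∃ h : ℕ → Form n k, (∀ l, HolFormAt 0 (h l)) ∧
        ∀ᶠ z in 𝓝 (0 : Cn n),
          α z = δ z + ∑ l ∈ Finset.range i, ω z (fun _ => c l) • h l z := by
  induction k with
  | zero =>
    intro i hi α hα g hg h
    obtain ⟨h', hh', he⟩ := regForm hr i (by omega) α hα
      (fun l z => (g l z).curryLeft (c i)) (fun l => hol_curry (hg l) _) (by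
        filter_upwards [h] with z hz
        rw [← wed_cons_zero, hz]
        exact curry_sum _ _ _ _)
    refine ⟨fun _ => 0, Eventually.of_forall fun _ => rfl, h', hh', ?_⟩
    simpa using he
  | succ k ih =>
    intro i hi α hα g hg h
    have hγ := hol_curry hα (c i)
    obtain ⟨δ, hδ, h1, hh1, he1⟩ := ih (i + 1) (by omega) _ hγ
      (fun l => if l = i then α else fun z => - (g l z).curryLeft (c i))
      (fun l => by
        split_ifs
        · exact hα
        · exact hol_neg (hol_curry (hg l) _)) (by
        filter_upwards [h] with z hz
        have e := wed_cons (ω z) (α z) (c i)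
        rw [hz] at e
        have e2 : ∑ l ∈ Finset.range i, ω z (fun _ => c l) • (if l = i then α else
            fun z => - (g l z).curryLeft (c i)) z =
            - (∑ l ∈ Finset.range i, ω z (fun _ => c l) • g l z).curryLeft (c i) := by
          rw [Finset.sum_congr rfl (g := fun l => - (ω z (fun _ => c l) • (g l z).curryLeft (c i)))
            (fun l hl => by rw [if_neg (Finset.mem_range.1 hl).ne, smul_neg])]
          rw [Finset.sum_neg_distrib]
          congr 1
          exact (curry_sum _ _ _ _).symm
        rw [Finset.sum_range_succ, e2, e, if_pos rfl]
        abel)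
    obtain ⟨h2, hh2, he2⟩ := regForm hr i (by omega) (fun z => α z - wed (ω z) (h1 i z))
      (hol_sub hα (hol_wed hω (hh1 i)))
      (fun l z => wed (ω z) (h1 l z) + (g l z).curryLeft (c i))
      (fun l => hol_add (hol_wed hω (hh1 l)) (hol_curry (hg l) _)) (by
        filter_upwards [h, he1, hδ.closed] with z hz h3 h4
        have e := wed_cons (ω z) (α z) (c i)
        rw [h3, hz, map_add, h4, Finset.sum_range_succ, map_add, map_sum, map_smul, zero_add] at e
        have e3 : (∑ l ∈ Finset.range i, ω z (fun _ => c l) • g l z).curryLeft (c i) =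
            ∑ l ∈ Finset.range i, ω z (fun _ => c l) • (g l z).curryLeft (c i) :=
          curry_sum _ _ _ _
        rw [e3] at e
        simp only [map_smul] at e
        simp only [smul_add, Finset.sum_add_distrib, smul_sub]
        rw [e]
        abel)
    refine ⟨fun z => wed (ω z) (h1 i z), ⟨h1 i, hh1 i, Eventually.of_forall fun _ => rfl⟩,
      h2, hh2, ?_⟩
    filter_upwards [he2] with z hz
    rw [← hz]; abel

/-- The division property (uniform in degree). -/
def DivProp {n : ℕ} (ω : Form n 1) (k : ℕ) : Prop :=
  ∀ α : Form n k, HolFormAt 0 α → (∀ᶠ z in 𝓝 (0 : Cn n), wed (ω z) (α z) = 0) → ExactF ω k α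

lemma div_of_ne {n : ℕ} {ω : Form n 1} (hω : HolFormAt 0 ω) (e : Cn n)
    (he : ω 0 (fun _ => e) ≠ 0) (k : ℕ) : DivProp ω k := by
  intro α hα h
  have hne : ∀ᶠ z in 𝓝 (0 : Cn n), ω z (fun _ => e) ≠ 0 :=
    (hω fun _ => e).continuousAt.eventually_ne he
  cases k with
  | zero =>
    change ∀ᶠ z in 𝓝 (0 : Cn n), α z = 0
    filter_upwards [h, hne] with z hz hn
    have := wed_cons_zero (ω z) (α z) e
    rw [hz] at this
    have h0 : ω z (fun _ => e) • α z = 0 := by rw [← this]; ext v; simp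
    exact (smul_eq_zero.1 h0).resolve_left hn
  | succ k =>
    refine ⟨fun z => (ω z (fun _ => e))⁻¹ • (α z).curryLeft e, fun v => ?_, ?_⟩
    · exact ((hω _).inv he).mul (hα _)
    · filter_upwards [h, hne] with z hz hn
      have := wed_cons (ω z) (α z) e
      rw [hz] at this
      have h0 : ω z (fun _ => e) • α z = wed (ω z) ((α z).curryLeft e) := by
        rw [← sub_eq_zero, ← this]; ext v; simp
      rw [map_smul, ← h0, smul_smul, inv_mul_cancel₀ hn, one_smul]

lemma omega_sum {n : ℕ} (w : AlternatingMap ℂ (Cn n) ℂ (Fin 1)) (c : Cn n) :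
    w (fun _ => c) = ∑ i, c i * w (fun _ => Pi.single i 1) := by
  let u : Cn n →ₗ[ℂ] ℂ := (AlternatingMap.ofSubsingleton ℂ (Cn n) ℂ (0 : Fin 1) |>.symm w)
  have hu : ∀ x, u x = w (fun _ => x) := fun x => rfl
  simp only [← hu]
  conv_lhs => rw [pi_eq_sum_univ' c]
  simp

lemma div_main {n p : ℕ} {ω : Form n 1} (hω : HolFormAt 0 ω)
    (hrk : p + 1 ≤ rkAt (fun z i => ω z fun _ => Pi.single i 1) 0) (k : ℕ) (hk : k ≤ p) :
    DivProp ω k := by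
  by_cases h0 : ∃ e : Cn n, ω 0 (fun _ => e) ≠ 0
  · obtain ⟨e, he⟩ := h0
    exact div_of_ne hω e he k
  push Not at h0
  set X : Cn n → Cn n := fun z i => ω z fun _ => Pi.single i 1 with hX
  have hXa : AnalyticAt ℂ X 0 := AnalyticAt.pi fun i => hω _
  set D := fderiv ℂ X 0 with hD
  have hXD : HasFDerivAt X D 0 := hXa.differentiableAt.hasFDerivAt
  obtain ⟨w, hw⟩ := exists_linearIndependent_of_le_finrank
    (R := ℂ) (M := LinearMap.range D.toLinearMap) (n := p + 1) hrk
  have hw' : LinearIndependent ℂ (fun l => (w l : Cn n)) :=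
    hw.map' (Submodule.subtype _) (Submodule.ker_subtype _)
  have hb : ∀ l, ∃ b, D b = (w l : Cn n) := fun l => (w l).2
  choose b hb using hb
  obtain ⟨U, hU⟩ := LinearMap.exists_leftInverse_of_injective
    (Fintype.linearCombination ℂ (fun l => (w l : Cn n)))
    (LinearMap.ker_eq_bot.2 (linearIndependent_iff_injective_fintypeLinearCombination.1 hw'))
  have hUw : ∀ l, U (w l : Cn n) = Pi.single l 1 := by
    intro l
    have := LinearMap.congr_fun hU (Pi.single l 1)
    simpa [Fintype.linearCombination_apply_single] using this
  let u : ℕ → Cn n →L[ℂ] ℂ := fun l => if h : l < p + 1 then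
    ((LinearMap.proj (⟨l, h⟩ : Fin (p + 1))).comp U).toContinuousLinearMap else 0
  let bb : ℕ → Cn n := fun l => if h : l < p + 1 then b ⟨l, h⟩ else 0
  let c : ℕ → Cn n := fun l i => u l (Pi.single i 1)
  have ha : ∀ l z, ω z (fun _ => c l) = u l (X z) := by
    intro l z
    rw [omega_sum]
    conv_rhs => rw [pi_eq_sum_univ' (X z)]
    simp only [map_sum, map_smul, smul_eq_mul]
    refine Finset.sum_congr rfl fun i _ => ?_
    simp [c, hX, mul_comm]
  have hd : DualSys (p + 1) (fun l => (u l).comp D) bb := by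
    intro l hl l' hl'
    simp only [bb, u, hl, hl', dif_pos, ContinuousLinearMap.comp_apply, hb]
    simp [hUw, Pi.single_apply]
  have hreg : RegSeq (p + 1) (fun l z => ω z (fun _ => c l)) := by
    refine regSeq_of hd _ (fun l => hω _) (fun l => h0 _) (fun l _ => ?_)
    simp only [ha]
    exact ((u l).hasFDerivAt.comp _ hXD).fderiv
  intro α hα h
  obtain ⟨δ, hδ, h', hh', he⟩ := claim hω c hreg k 0 (by omega) α hα (fun _ _ => 0)
    (fun _ _ => analyticAt_const) (by simpa using h)
  simp only [Finset.range_zero, Finset.sum_empty, add_zero] at he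
  cases k with
  | zero =>
    change ∀ᶠ z in 𝓝 (0 : Cn n), δ z = 0 at hδ
    change ∀ᶠ z in 𝓝 (0 : Cn n), α z = 0
    filter_upwards [he, hδ] with z h1 h2
    rw [h1, h2]
  | succ k =>
    obtain ⟨β, hβ, hδ⟩ := hδ
    refine ⟨β, hβ, ?_⟩
    filter_upwards [he, hδ] with z h1 h2
    rw [h1, h2]

end Forms

/-- Proposition 5.8: Let `ω` be a germ of holomorphic `1`-form at
`0 ∈ ℂⁿ` whose linear part has rank at least `p + 1` (the rank of the linear part of
`ω = Σ Aᵢ dxᵢ` being the rank of the derivative at `0` of the associated vector field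
`X_ω = Σ Aᵢ ∂/∂xᵢ`). Then `ω` satisfies the division property by `k`-forms for all
`k ≤ p`: every germ of holomorphic `k`-form `α` with `ω ∧ α = 0` can be written
`α = ω ∧ β` for a germ of holomorphic `(k-1)`-form `β` (for `k = 0` this means `α = 0`). -/
theorem statement_18 (n p : ℕ) (ω : Form n 1) (hω : HolFormAt 0 ω)
    (hrk : p + 1 ≤ rkAt (fun z i => ω z fun _ => Pi.single i 1) 0) :
    (∀ α : Form n 0, HolFormAt 0 α →
      (∀ᶠ z in 𝓝 (0 : Cn n), ∀ v : Fin 1 → Cn n, wedge1 ω α z v = 0) →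
      ∀ᶠ z in 𝓝 (0 : Cn n), α z = 0) ∧
    (∀ j : ℕ, j + 1 ≤ p → ∀ α : Form n (j + 1), HolFormAt 0 α →
      (∀ᶠ z in 𝓝 (0 : Cn n), ∀ v : Fin (j + 2) → Cn n, wedge1 ω α z v = 0) →
      ∃ β : Form n j, HolFormAt 0 β ∧
        ∀ᶠ z in 𝓝 (0 : Cn n), ∀ v : Fin (j + 1) → Cn n, α z v = wedge1 ω β z v) := by
  have conv : ∀ (k : ℕ) (α : Form n k),
      (∀ᶠ z in 𝓝 (0 : Cn n), ∀ v : Fin (k + 1) → Cn n, wedge1 ω α z v = 0) →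
      ∀ᶠ z in 𝓝 (0 : Cn n), wed (ω z) (α z) = 0 := by
    intro k α h
    filter_upwards [h] with z hz
    ext v
    rw [← wedge1_eq, hz]; rfl
  constructor
  · intro α hα h
    exact div_main hω hrk 0 (Nat.zero_le _) α hα (conv 0 α h)
  · intro j hj α hα h
    obtain ⟨β, hβ, hb⟩ := div_main hω hrk (j + 1) hj α hα (conv (j + 1) α h)
    refine ⟨β, hβ, ?_⟩
    filter_upwards [hb] with z hz v
    rw [wedge1_eq, hz]
end

section
/- Let D be a codimension one singular holomorphic distribution on ℙ^3 with locally free tangent sheaf и deg(D) ≥ 1, and assume D is tangent to a nonnilpotent holomorphic vector field on ℙ^3. Then the tangent sheaf T_D splits, i.e. T_D ≅ O_{ℙ^3}(a) ⊕ O_{ℙ^3}(b) for some integers a, b. -/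
open Topology Filter Set
open scoped ENNReal Manifold

theorem homog_poly (f : Cn 4 → ℂ) (m : ℕ) (hf : AnalyticAt ℂ f 0)
    (hh : ∀ (t : ℂ) (z : Cn 4), f (t • z) = t ^ m * f z) :
    ∃ P : MvPolynomial (Fin 4) ℂ, ∀ z, f z = MvPolynomial.eval z P := by
  obtain ⟨p, r, hp⟩ := hf
  have key : ∀ z, f z = p m (fun _ => z) := by
    intro z
    set L : ℂ →L[ℂ] Cn 4 := ContinuousLinearMap.toSpanSingleton ℂ z with hL
    have h1 : HasFPowerSeriesAt (fun t => f (L t)) (p.compContinuousLinearMap L) 0 := by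
      have : HasFPowerSeriesAt f p (L 0) := by simpa using hp.hasFPowerSeriesAt
      exact HasFPowerSeriesAt.compContinuousLinearMap this
    obtain ⟨r', h2⟩ := h1
    have h3 := h2.factorial_smul (1 : ℂ) m
    have h4 : (fun t => f (L t)) = fun t : ℂ => f z * t ^ m := by
      funext t
      simp [L, hh, mul_comm]
    rw [h4] at h3
    have h5 : iteratedFDeriv ℂ m (fun t : ℂ => f z * t ^ m) 0 (fun _ => (1:ℂ)) =
        (m.factorial : ℂ) * f z := by
      rw [← iteratedDeriv_eq_iteratedFDeriv]
      rw [iteratedDeriv_const_mul_field, iteratedDeriv_fun_pow_zero]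
      simp [mul_comm]
    rw [h5, nsmul_eq_mul] at h3
    have h6 := mul_left_cancel₀ (Nat.cast_ne_zero.mpr (Nat.factorial_ne_zero m)) h3
    rw [← h6]
    simp [FormalMultilinearSeries.compContinuousLinearMap, L]
  refine ⟨∑ s : Fin m → Fin 4, MvPolynomial.C (p m (fun j => Pi.single (s j) (1:ℂ))) *
    ∏ j, MvPolynomial.X (s j), fun z => ?_⟩
  rw [key z]
  have hz : (fun _ : Fin m => z) = fun _ : Fin m => ∑ i : Fin 4, z i • (Pi.single i (1:ℂ) : Cn 4) := by
    funext _
    ext k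
    simp [Finset.sum_apply, Pi.single_apply]
  rw [hz, ContinuousMultilinearMap.map_sum]
  simp only [ContinuousMultilinearMap.map_smul_univ, map_sum, map_mul, MvPolynomial.eval_C,
    map_prod, MvPolynomial.eval_X, smul_eq_mul]
  exact Finset.sum_congr rfl fun s _ => mul_comm _ _

/-- Polynomials in four variables. -/
abbrev P4 : Type := MvPolynomial (Fin 4) ℂ

/-- The polynomial of a linear form. -/
noncomputable def linP (φ : Cn 4 →ₗ[ℂ] ℂ) : P4 :=
  ∑ i, MvPolynomial.C (φ (Pi.single i 1)) * MvPolynomial.X i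

theorem eval_linP (φ : Cn 4 →ₗ[ℂ] ℂ) (z : Cn 4) : MvPolynomial.eval z (linP φ) = φ z := by
  have hz : z = ∑ i : Fin 4, z i • (Pi.single i (1:ℂ) : Cn 4) := by
    ext k
    simp [Finset.sum_apply, Pi.single_apply]
  conv_rhs => rw [hz]
  simp [linP, mul_comm]

theorem p4_ext {a b : P4} (h : ∀ z, MvPolynomial.eval z a = MvPolynomial.eval z b) : a = b :=
  MvPolynomial.funext h

/-- restriction to a linear subspace as a ring hom, with control of the kernel -/
theorem restr_hom {k : ℕ} (φ : Fin k → (Cn 4 →ₗ[ℂ] ℂ))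
    (hs : Function.Surjective (LinearMap.pi φ)) :
    ∃ (ψ : P4 →ₐ[ℂ] P4) (π : Cn 4 → Cn 4), (∀ z i, φ i (π z) = 0) ∧
      (∀ z, (∀ i, φ i z = 0) → π z = z) ∧
      (∀ z h, MvPolynomial.eval z (ψ h) = MvPolynomial.eval (π z) h) ∧
      ∀ h, ∃ a : Fin k → P4, h - ψ h = ∑ i, linP (φ i) * a i := by
  classical
  choose u hu using fun j : Fin k => hs (Pi.single j 1)
  have hu' : ∀ i j, φ i (u j) = if i = j then 1 else 0 := by
    intro i j
    have := congrFun (hu j) i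
    simpa [Pi.single_apply] using this
  let ψ : P4 →ₐ[ℂ] P4 := MvPolynomial.aeval
    (fun j => MvPolynomial.X j - ∑ i, linP (φ i) * MvPolynomial.C (u i j))
  let π : Cn 4 → Cn 4 := fun z => z - ∑ i, φ i z • u i
  refine ⟨ψ, π, ?_, ?_, ?_, ?_⟩
  · intro z i
    simp [π, hu']
  · intro z hz
    simp [π, hz]
  · intro z h
    have : (MvPolynomial.aeval z : P4 →ₐ[ℂ] ℂ).comp ψ = MvPolynomial.aeval (π z) := by
      ext j
      simp only [ψ, π, AlgHom.comp_apply, MvPolynomial.aeval_X, map_sub, map_sum, map_mul]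
      simp [Finset.sum_apply, eval_linP]
    have := DFunLike.congr_fun this h
    simpa [MvPolynomial.coe_aeval_eq_eval] using this
  · intro h
    let I : Ideal P4 := Ideal.span (Set.range fun i => linP (φ i))
    have : (Ideal.Quotient.mkₐ ℂ I).comp ψ = Ideal.Quotient.mkₐ ℂ I := by
      ext j
      simp only [ψ, AlgHom.comp_apply, MvPolynomial.aeval_X, Ideal.Quotient.mkₐ_eq_mk]
      rw [Ideal.Quotient.mk_eq_mk_iff_sub_mem]
      rw [sub_sub_cancel_left]
      refine I.neg_mem (I.sum_mem fun i _ => I.mul_mem_right _ (Ideal.subset_span ⟨i, rfl⟩))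
    have h2 := DFunLike.congr_fun this h
    simp only [AlgHom.comp_apply, Ideal.Quotient.mkₐ_eq_mk] at h2
    have h3 : h - ψ h ∈ I := (Ideal.Quotient.mk_eq_mk_iff_sub_mem _ _).1 h2.symm
    rw [Ideal.mem_span_range_iff_exists_fun] at h3
    obtain ⟨c, hc⟩ := h3
    exact ⟨c, by rw [← hc]; exact Finset.sum_congr rfl fun i _ => mul_comm _ _⟩

theorem mem_of_vanish {k : ℕ} (φ : Fin k → (Cn 4 →ₗ[ℂ] ℂ))
    (hs : Function.Surjective (LinearMap.pi φ)) (h : P4)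
    (hv : ∀ z, (∀ i, φ i z = 0) → MvPolynomial.eval z h = 0) :
    ∃ a : Fin k → P4, h = ∑ i, linP (φ i) * a i := by
  obtain ⟨ψ, π, h1, h2, h3, h4⟩ := restr_hom φ hs
  obtain ⟨a, ha⟩ := h4 h
  refine ⟨a, ?_⟩
  have : ψ h = 0 := p4_ext fun z => by rw [h3, hv _ (h1 z)]; simp
  rw [← ha, this, sub_zero]

/-- primeness of linear ideals -/
theorem vanish_of_mul {k : ℕ} (φ : Fin k → (Cn 4 →ₗ[ℂ] ℂ))
    (hs : Function.Surjective (LinearMap.pi φ)) (h n : P4)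
    (hv : ∀ z, (∀ i, φ i z = 0) → MvPolynomial.eval z h * MvPolynomial.eval z n = 0)
    (hn : ∃ z, (∀ i, φ i z = 0) ∧ MvPolynomial.eval z n ≠ 0) :
    ∀ z, (∀ i, φ i z = 0) → MvPolynomial.eval z h = 0 := by
  obtain ⟨ψ, π, h1, h2, h3, h4⟩ := restr_hom φ hs
  have h5 : ψ h * ψ n = 0 := p4_ext fun z => by
    rw [map_mul, h3, h3, hv _ (h1 z)]; simp
  rcases mul_eq_zero.1 h5 with h6 | h6
  · intro z hz
    have := h3 z h
    rw [h6, h2 z hz] at this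
    simpa using this.symm
  · obtain ⟨z, hz, hz'⟩ := hn
    have := h3 z n
    rw [h6, h2 z hz] at this
    exact absurd (by simpa using this.symm) hz'

theorem mem_of_mul {k : ℕ} (φ : Fin k → (Cn 4 →ₗ[ℂ] ℂ))
    (hs : Function.Surjective (LinearMap.pi φ)) (h n : P4)
    (hv : ∀ z, (∀ i, φ i z = 0) → MvPolynomial.eval z h * MvPolynomial.eval z n = 0)
    (hn : ∃ z, (∀ i, φ i z = 0) ∧ MvPolynomial.eval z n ≠ 0) :
    ∃ a : Fin k → P4, h = ∑ i, linP (φ i) * a i :=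
  mem_of_vanish φ hs h (vanish_of_mul φ hs h n hv hn)

theorem koszul2 (φ1 φ2 : Cn 4 →ₗ[ℂ] ℂ) (hs : Function.Surjective (LinearMap.pi ![φ1, φ2]))
    (a b : P4) (hab : linP φ1 * a + linP φ2 * b = 0) :
    ∃ c, a = linP φ2 * c ∧ b = - (linP φ1 * c) := by
  have hs1 : Function.Surjective (LinearMap.pi ![φ1]) := by
    intro v
    obtain ⟨z, hz⟩ := hs ![v 0, 0]
    exact ⟨z, by ext i; fin_cases i; simpa using congrFun hz 0⟩
  obtain ⟨z, hz⟩ := hs ![0, 1]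
  have hz0 : φ1 z = 0 := by simpa using congrFun hz 0
  have hz1 : φ2 z = 1 := by simpa using congrFun hz 1
  obtain ⟨c, hc⟩ := mem_of_mul ![φ1] hs1 b (linP φ2) (by
    intro y hy
    have h0 : φ1 y = 0 := by simpa using hy 0
    have := congrArg (MvPolynomial.eval y) hab
    simpa [eval_linP, h0, mul_comm] using this) ⟨z, by simpa using hz0, by simp [eval_linP, hz1]⟩
  have hc' : b = linP φ1 * c 0 := by simpa using hc
  have hne : linP φ1 ≠ 0 := by
    intro h0
    obtain ⟨z, hz⟩ := hs ![1, 0]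
    have : φ1 z = 1 := by simpa using congrFun hz 0
    rw [← eval_linP, h0] at this
    simp at this
  refine ⟨-c 0, ?_, by rw [hc']; ring⟩
  apply mul_left_cancel₀ hne
  rw [hc'] at hab
  linear_combination hab

theorem koszul3 (φ1 φ2 φ3 : Cn 4 →ₗ[ℂ] ℂ)
    (hs : Function.Surjective (LinearMap.pi ![φ1, φ2, φ3]))
    (a b c : P4) (habc : linP φ1 * a + linP φ2 * b + linP φ3 * c = 0) :
    ∃ d1 d2 d3, a = linP φ2 * d3 - linP φ3 * d2 ∧ b = linP φ3 * d1 - linP φ1 * d3 ∧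
      c = linP φ1 * d2 - linP φ2 * d1 := by
  have hs2 : Function.Surjective (LinearMap.pi ![φ1, φ2]) := by
    intro v
    obtain ⟨z, hz⟩ := hs ![v 0, v 1, 0]
    refine ⟨z, ?_⟩
    ext i
    fin_cases i
    · simpa using congrFun hz 0
    · simpa using congrFun hz 1
  obtain ⟨z, hz⟩ := hs ![0, 0, 1]
  have hz0 : φ1 z = 0 := by simpa using congrFun hz 0
  have hz1 : φ2 z = 0 := by simpa using congrFun hz 1
  have hz2 : φ3 z = 1 := by simpa using congrFun hz 2
  obtain ⟨e, he⟩ := mem_of_mul ![φ1, φ2] hs2 c (linP φ3) (by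
    intro y hy
    have h0 : φ1 y = 0 := by simpa using hy 0
    have h1 : φ2 y = 0 := by simpa using hy 1
    have := congrArg (MvPolynomial.eval y) habc
    simpa [eval_linP, h0, h1, mul_comm] using this)
    ⟨z, by intro i; fin_cases i <;> simp [hz0, hz1], by simp [eval_linP, hz2]⟩
  have hexp : c = linP φ1 * e 0 + linP φ2 * e 1 := by simpa [Fin.sum_univ_two] using he
  obtain ⟨f, hf1, hf2⟩ := koszul2 φ1 φ2 hs2 (a + linP φ3 * e 0) (b + linP φ3 * e 1) (by
    rw [hexp] at habc
    linear_combination habc)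
  exact ⟨-e 1, e 0, f, by linear_combination hf1, by linear_combination hf2,
    by linear_combination hexp⟩

/-- Basic data of a homogeneous one-form on `ℂ⁴` killed by the radial field. -/
structure OmDat (om : Cn 4 → Cn 4 →ₗ[ℂ] ℂ) (d : ℕ) : Prop where
  hol : ∀ v, AnalyticOnNhd ℂ (fun z => om z v) univ
  homog : ∀ (t : ℂ) z v, om (t • z) v = t ^ (d + 1) * om z v
  rad : ∀ z, om z z = 0

/-- Splitting for one-forms. -/
def OmSplits (om : Cn 4 → Cn 4 →ₗ[ℂ] ℂ) : Prop :=
  ∃ (X1 X2 : Cn 4 → Cn 4) (d1 d2 : ℕ) (c : ℂ), c ≠ 0 ∧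
    AnalyticOnNhd ℂ X1 Set.univ ∧ AnalyticOnNhd ℂ X2 Set.univ ∧
    (∀ (t : ℂ) z, X1 (t • z) = t ^ d1 • X1 z) ∧
    (∀ (t : ℂ) z, X2 (t • z) = t ^ d2 • X2 z) ∧
    ∀ z v, om z v = c * (Pi.basisFun ℂ (Fin 4)).det ![X1 z, X2 z, z, v]

theorem det_lin3 (f : (Cn 4) [⋀^Fin 4]→ₗ[ℂ] ℂ) (x y z : Cn 4) :
    ∃ g : Cn 4 →ₗ[ℂ] ℂ, ∀ v, g v = f ![x, y, z, v] := by
  refine ⟨f.toMultilinearMap.toLinearMap ![x, y, z, 0] 3, fun v => ?_⟩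
  simp only [MultilinearMap.toLinearMap_apply, AlternatingMap.coe_multilinearMap]
  congr 1
  ext i j
  fin_cases i <;> simp [Function.update]

theorem det_lin1 (f : (Cn 4) [⋀^Fin 4]→ₗ[ℂ] ℂ) (x z v : Cn 4) :
    ∃ g : Cn 4 →ₗ[ℂ] ℂ, ∀ y, g y = f ![x, y, z, v] := by
  refine ⟨f.toMultilinearMap.toLinearMap ![x, 0, z, v] 1, fun y => ?_⟩
  simp only [MultilinearMap.toLinearMap_apply, AlternatingMap.coe_multilinearMap]
  congr 1
  ext i j
  fin_cases i <;> simp [Function.update]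

theorem det_lin0 (f : (Cn 4) [⋀^Fin 4]→ₗ[ℂ] ℂ) (y z v : Cn 4) :
    ∃ g : Cn 4 →ₗ[ℂ] ℂ, ∀ x, g x = f ![x, y, z, v] := by
  refine ⟨f.toMultilinearMap.toLinearMap ![0, y, z, v] 0, fun x => ?_⟩
  simp only [MultilinearMap.toLinearMap_apply, AlternatingMap.coe_multilinearMap]
  congr 1
  ext i j
  fin_cases i <;> simp [Function.update]

theorem det_lin2 (f : (Cn 4) [⋀^Fin 4]→ₗ[ℂ] ℂ) (x y v : Cn 4) :
    ∃ g : Cn 4 →ₗ[ℂ] ℂ, ∀ z, g z = f ![x, y, z, v] := by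
  refine ⟨f.toMultilinearMap.toLinearMap ![x, y, 0, v] 2, fun z => ?_⟩
  simp only [MultilinearMap.toLinearMap_apply, AlternatingMap.coe_multilinearMap]
  congr 1
  ext i j
  fin_cases i <;> simp [Function.update]

theorem eval_homComp (n : ℕ) (P : P4) (t : ℂ) (z : Cn 4) :
    MvPolynomial.eval (t • z) (MvPolynomial.homogeneousComponent n P) =
      t ^ n * MvPolynomial.eval z (MvPolynomial.homogeneousComponent n P) := by
  have h := MvPolynomial.homogeneousComponent_isHomogeneous n P
  rw [MvPolynomial.eval_eq, MvPolynomial.eval_eq, Finset.mul_sum]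
  refine Finset.sum_congr rfl fun s hs => ?_
  have h1 : s.degree = n := h (MvPolynomial.mem_support_iff.1 hs) |> fun h => by
    rw [← h, Finsupp.degree_eq_weight_one]; rfl
  have h2 : ∏ i ∈ s.support, (t • z) i ^ s i = t ^ n * ∏ i ∈ s.support, z i ^ s i := by
    simp only [Pi.smul_apply, smul_eq_mul, mul_pow, Finset.prod_mul_distrib]
    rw [Finset.prod_pow_eq_pow_sum, ← h1]
    rfl
  rw [h2]
  ring

theorem analytic_eval (P : P4) : AnalyticOnNhd ℂ (fun z : Cn 4 => MvPolynomial.eval z P) univ :=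
  AnalyticOnNhd.eval_mvPolynomial P

theorem om_finish {om : Cn 4 → Cn 4 →ₗ[ℂ] ℂ} {d : ℕ} (hom : OmDat om d)
    (b : Module.Basis (Fin 4) ℂ (Cn 4)) (X1 : Cn 4 → Cn 4) (d1 : ℕ) (hd : d1 ≤ d)
    (hX : AnalyticOnNhd ℂ X1 univ) (hX1 : ∀ (t : ℂ) z, X1 (t • z) = t ^ d1 • X1 z)
    (Yp : Fin 4 → P4)
    (h : ∀ z i, om z (b i) = b.det ![X1 z, ∑ j, MvPolynomial.eval z (Yp j) • b j, z, b i]) :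
    OmSplits om := by
  let Yn : ℕ → Cn 4 → Cn 4 := fun n z =>
    ∑ j, MvPolynomial.eval z (MvPolynomial.homogeneousComponent n (Yp j)) • b j
  have hYn : ∀ n (t : ℂ) z, Yn n (t • z) = t ^ n • Yn n z := by
    intro n t z
    simp only [Yn, eval_homComp, Finset.smul_sum, smul_smul]
  obtain ⟨N, hN, hNd⟩ : ∃ N, (∀ j, (Yp j).totalDegree < N) ∧ d < N := by
    refine ⟨(∑ j, (Yp j).totalDegree) + d + 1, fun j => ?_, by omega⟩
    have := Finset.single_le_sum (f := fun j => (Yp j).totalDegree) (fun i _ => Nat.zero_le _)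
      (Finset.mem_univ j)
    omega
  have hsum : ∀ z, ∑ j, MvPolynomial.eval z (Yp j) • b j = ∑ n ∈ Finset.range N, Yn n z := by
    intro z
    simp only [Yn]
    rw [Finset.sum_comm]
    refine Finset.sum_congr rfl fun j _ => ?_
    rw [← Finset.sum_smul, ← map_sum]
    congr 2
    conv_lhs => rw [← MvPolynomial.sum_homogeneousComponent (Yp j)]
    refine Finset.sum_subset (Finset.range_mono (hN j)) fun n _ hn => ?_
    apply MvPolynomial.homogeneousComponent_eq_zero
    simpa using hn
  have h1 : ∀ z v, om z v = b.det ![X1 z, ∑ n ∈ Finset.range N, Yn n z, z, v] := by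
    intro z v
    obtain ⟨g, hg⟩ := det_lin3 b.det (X1 z) (∑ n ∈ Finset.range N, Yn n z) z
    rw [← hg]
    congr 1
    refine b.ext fun i => ?_
    rw [hg, h, hsum]
  have h2 : ∀ z v, om z v = ∑ n ∈ Finset.range N, b.det ![X1 z, Yn n z, z, v] := by
    intro z v
    obtain ⟨g, hg⟩ := det_lin1 b.det (X1 z) z v
    rw [h1, ← hg, map_sum]
    simp only [hg]
  have h3 : ∀ n (t : ℂ) z v, b.det ![X1 (t • z), Yn n (t • z), t • z, v] =
      t ^ (d1 + n + 1) * b.det ![X1 z, Yn n z, z, v] := by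
    intro n t z v
    rw [hX1, hYn]
    obtain ⟨g, hg⟩ := det_lin0 b.det (t ^ n • Yn n z) (t • z) v
    obtain ⟨g1, hg1⟩ := det_lin1 b.det (X1 z) (t • z) v
    obtain ⟨g2, hg2⟩ := det_lin2 b.det (X1 z) (Yn n z) v
    rw [← hg, map_smul, hg, ← hg1, map_smul, hg1, ← hg2, map_smul, hg2]
    simp only [smul_eq_mul]
    ring
  have h4 : ∀ z v, om z v = b.det ![X1 z, Yn (d - d1) z, z, v] := by
    intro z v
    let Q : Polynomial ℂ := ∑ n ∈ Finset.range N,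
      Polynomial.C (b.det ![X1 z, Yn n z, z, v]) * Polynomial.X ^ (d1 + n + 1)
    have hQ : Q = Polynomial.C (om z v) * Polynomial.X ^ (d + 1) := by
      refine Polynomial.funext fun t => ?_
      have e1 := hom.homog t z v
      rw [h2 (t • z) v] at e1
      simp only [h3] at e1
      simp only [Q, Polynomial.eval_finsetSum, Polynomial.eval_mul, Polynomial.eval_C,
        Polynomial.eval_pow, Polynomial.eval_X]
      rw [mul_comm (om z v), ← e1]
      exact Finset.sum_congr rfl fun n _ => mul_comm _ _
    have e2 := congrArg (fun q => Polynomial.coeff q (d + 1)) hQ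
    simp only [Q, Polynomial.finsetSum_coeff, Polynomial.coeff_C_mul, Polynomial.coeff_X_pow,
      if_true, mul_one] at e2
    rw [← e2, Finset.sum_eq_single (d - d1)]
    · rw [if_pos (by omega), mul_one]
    · intro n _ hn
      rw [if_neg (by omega), mul_zero]
    · intro hn
      simp at hn
      omega
  refine ⟨X1, Yn (d - d1), d1, d - d1, b.det (Pi.basisFun ℂ (Fin 4)),
    (b.isUnit_det _).ne_zero, hX, ?_, hX1, hYn _, ?_⟩
  · have : ∀ j, AnalyticOnNhd ℂ (fun z : Cn 4 => MvPolynomial.eval z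
        (MvPolynomial.homogeneousComponent (d - d1) (Yp j)) • b j) univ := fun j =>
      (analytic_eval _).smul analyticOnNhd_const
    simp only [Yn]
    exact Finset.analyticOnNhd_fun_sum _ fun j _ => this j
  · intro z v
    rw [h4]
    conv_lhs => rw [AlternatingMap.eq_smul_basis_det (Pi.basisFun ℂ (Fin 4)) b.det]
    simp

theorem dense_good (Z : Set (Cn 4)) (hZ : dimH Z ≤ 4) (w : Cn 4) (hw : w ≠ 0) :
    Dense {z : Cn 4 | ∀ t : ℂ, z + t • w ∉ Z} := by
  have hq : Module.finrank ℂ ((Cn 4) ⧸ (Submodule.span ℂ {w})) = Module.finrank ℂ (Cn 3) := by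
    have h1 := Submodule.finrank_quotient_add_finrank (Submodule.span ℂ {w})
    rw [finrank_span_singleton hw] at h1
    simp at h1 ⊢
    omega
  let e := LinearEquiv.ofFinrankEq _ _ hq
  let π : Cn 4 →ₗ[ℂ] Cn 3 := e.toLinearMap ∘ₗ (Submodule.span ℂ {w}).mkQ
  have hπs : Function.Surjective π := e.surjective.comp (Submodule.mkQ_surjective _)
  have hπw : π w = 0 := by
    simp only [π, LinearMap.comp_apply, LinearEquiv.coe_coe, map_eq_zero_iff e e.injective, Submodule.mkQ_apply]
    rw [Submodule.Quotient.mk_eq_zero]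
    exact Submodule.mem_span_singleton_self w
  have hlip := (LinearMap.toContinuousLinearMap π).lipschitz
  have hd : dimH (π '' Z) < (Module.finrank ℝ (Cn 3) : ℝ≥0∞) := by
    refine lt_of_le_of_lt ((hlip.dimH_image_le Z).trans hZ) ?_
    have : Module.finrank ℝ (Cn 3) = 6 := by
      rw [Module.finrank_pi_fintype]; simp
    rw [this]
    norm_num
  have h2 := (dense_compl_of_dimH_lt_finrank hd).preimage
    (LinearMap.isOpenMap_of_finiteDimensional π hπs)
  refine h2.mono ?_
  intro z hz t ht
  have hz1 : π z ∉ π '' Z := hz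
  refine hz1 ⟨_, ht, ?_⟩
  rw [map_add, map_smul, hπw, smul_zero, add_zero]

theorem hartogs_bound (N k : Cn 4 → Cn 4) (q w : Cn 4) (Z : Set (Cn 4)) (hZ : dimH Z ≤ 4)
    (hN : AnalyticAt ℂ N q) (hk : AnalyticAt ℂ k q) (hw : w ≠ 0)
    (hprop : ∀ᶠ z in 𝓝 q, ∀ i j, N z i * k z j = N z j * k z i)
    (hkZ : ∀ᶠ z in 𝓝 q, k z = 0 → z ∈ Z)
    (hkw : ∀ᶠ t in 𝓝 (0 : ℂ), t ≠ 0 → k (q + t • w) ≠ 0)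
    (hNw : ∀ᶠ t in 𝓝 (0 : ℂ), N (q + t • w) = 0) :
    ∃ C : ℝ, ∀ᶠ t in 𝓝 (0 : ℂ), ∀ u,
      ‖fderiv ℂ N (q + t • w) u‖ ≤ C * ‖u‖ * ‖k (q + t • w)‖ := by
  obtain ⟨K, s1, hs1, hK⟩ := (hN.contDiffAt (n := 1)).exists_lipschitzOnWith
  obtain ⟨K', s2, hs2, hK'⟩ := (hk.contDiffAt (n := 1)).exists_lipschitzOnWith
  obtain ⟨ρ, hρ, hball⟩ := Metric.eventually_nhds_iff_ball.1
    (hprop.and (hkZ.and (hN.eventually_analyticAt.and (hk.eventually_analyticAt.and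
      ((Filter.eventually_mem_set.2 hs1).and (Filter.eventually_mem_set.2 hs2))))))
  obtain ⟨r1, hr1, hr1'⟩ := Metric.eventually_nhds_iff_ball.1 (hkw.and hNw)
  have hwn : 0 < ‖w‖ := norm_pos_iff.2 hw
  obtain ⟨r, hr, hrr1, hrρ⟩ : ∃ r : ℝ, 0 < r ∧ r < r1 ∧ r * ‖w‖ < ρ / 2 := by
    refine ⟨min (r1 / 2) (ρ / 4 / ‖w‖), by positivity, ?_, ?_⟩
    · exact (min_le_left _ _).trans_lt (by linarith)
    · calc min (r1 / 2) (ρ / 4 / ‖w‖) * ‖w‖ ≤ ρ / 4 / ‖w‖ * ‖w‖ := by gcongr; exact min_le_right _ _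
        _ = ρ / 4 := by field_simp
        _ < ρ / 2 := by linarith
  have hin : ∀ z ∈ Metric.ball q (ρ / 2), ∀ t ∈ Metric.closedBall (0 : ℂ) r,
      z + t • w ∈ Metric.ball q ρ := by
    intro z hz t ht
    rw [Metric.mem_ball, dist_eq_norm] at hz ⊢
    rw [mem_closedBall_zero_iff] at ht
    calc ‖z + t • w - q‖ = ‖(z - q) + t • w‖ := by congr 1; abel
      _ ≤ ‖z - q‖ + ‖t‖ * ‖w‖ := by rw [← norm_smul]; exact norm_add_le _ _
      _ ≤ ‖z - q‖ + r * ‖w‖ := by gcongr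
      _ < ρ := by linarith
  have hqin : q ∈ Metric.ball q (ρ / 2) := Metric.mem_ball_self (by linarith)
  -- lower bound on the circle
  obtain ⟨m, hm, hmle⟩ : ∃ m : ℝ, 0 < m ∧ ∀ t ∈ Metric.sphere (0 : ℂ) r, m ≤ ‖k (q + t • w)‖ := by
    have hc : ContinuousOn (fun t : ℂ => ‖k (q + t • w)‖) (Metric.sphere (0 : ℂ) r) := by
      intro t ht
      have h1 := (hball _ (hin q hqin t (Metric.sphere_subset_closedBall ht))).2.2.2.1.continuousAt
      have h2 : ContinuousAt (fun t : ℂ => q + t • w) t := by fun_prop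
      exact (ContinuousAt.comp (f := fun t : ℂ => q + t • w) (g := k) h1 h2).norm.continuousWithinAt
    obtain ⟨t0, ht0, hmin⟩ := (isCompact_sphere (0 : ℂ) r).exists_isMinOn
      (NormedSpace.sphere_nonempty.2 hr.le) hc
    refine ⟨_, ?_, fun t ht => hmin ht⟩
    rw [norm_pos_iff]
    have : ‖t0‖ = r := by simpa using ht0
    refine (hr1' t0 (by simpa [this] using hrr1)).1 ?_
    rw [← norm_pos_iff, this]
    exact hr
  obtain ⟨δ, hδ, hδρ, hδm⟩ : ∃ δ : ℝ, 0 < δ ∧ δ ≤ ρ / 2 ∧ K' * δ ≤ m / 2 := by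
    refine ⟨min (ρ / 2) (m / 2 / (K' + 1)), by positivity, min_le_left _ _, ?_⟩
    calc K' * min (ρ / 2) (m / 2 / (K' + 1)) ≤ (K' + 1) * (m / 2 / (K' + 1)) := by
          gcongr
          · linarith
          · exact min_le_right _ _
      _ = m / 2 := by field_simp
  set C : ℝ := K / (m / 2) with hC
  have hC0 : 0 ≤ C := by positivity
  have hNz : ∀ t ∈ Metric.closedBall (0 : ℂ) r, N (q + t • w) = 0 := by
    intro t ht
    refine (hr1' t ?_).2
    rw [mem_closedBall_zero_iff] at ht
    rw [mem_ball_zero_iff]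
    linarith
  have hgood : ∀ z ∈ Metric.ball q δ, (∀ t : ℂ, z + t • w ∉ Z) →
      ∀ t ∈ Metric.closedBall (0 : ℂ) r, ‖N (z + t • w)‖ ≤ C * ‖z - q‖ * ‖k (z + t • w)‖ := by
    intro z hz hzZ
    have hz2 : z ∈ Metric.ball q (ρ / 2) := Metric.ball_subset_ball hδρ hz
    have hne : ∀ t, z + t • w ∈ Metric.ball q ρ → k (z + t • w) ≠ 0 := fun t ht h0 =>
      hzZ t ((hball _ ht).2.1 h0)
    have hex : ∀ t : ℂ, ∃ i, z + t • w ∈ Metric.ball q ρ → k (z + t • w) i ≠ 0 := by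
      intro t
      by_cases ht : z + t • w ∈ Metric.ball q ρ
      · obtain ⟨i, hi⟩ := Function.ne_iff.1 (hne t ht)
        exact ⟨i, fun _ => hi⟩
      · exact ⟨0, fun h => absurd h ht⟩
    choose ι hι using hex
    let f : ℂ → ℂ := fun t => N (z + t • w) (ι t) / k (z + t • w) (ι t)
    have hNf : ∀ t, z + t • w ∈ Metric.ball q ρ → N (z + t • w) = f t • k (z + t • w) := by
      intro t ht
      ext j
      have h1 := (hball _ ht).1 (ι t) j
      have h2 := hι t ht
      simp only [f, Pi.smul_apply, smul_eq_mul]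
      field_simp
      rw [mul_comm, h1]
      try ring
    have hdiff : ∀ t ∈ Metric.closedBall (0 : ℂ) r, DifferentiableAt ℂ f t := by
      intro t0 ht0
      have hb := hin z hz2 t0 ht0
      have hc : ContinuousAt (fun t : ℂ => z + t • w) t0 := by fun_prop
      have hda : DifferentiableAt ℂ (fun t : ℂ => z + t • w) t0 := by fun_prop
      have hkd : DifferentiableAt ℂ (fun t : ℂ => k (z + t • w) (ι t0)) t0 := by
        have := DifferentiableAt.comp (f := fun t : ℂ => z + t • w) (g := k) t0
          (hball _ hb).2.2.2.1.differentiableAt hda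
        exact differentiableAt_pi.1 this (ι t0)
      have hNd : DifferentiableAt ℂ (fun t : ℂ => N (z + t • w) (ι t0)) t0 := by
        have := DifferentiableAt.comp (f := fun t : ℂ => z + t • w) (g := N) t0
          (hball _ hb).2.2.1.differentiableAt hda
        exact differentiableAt_pi.1 this (ι t0)
      have h0 := hι t0 hb
      have hev : f =ᶠ[𝓝 t0] fun t => N (z + t • w) (ι t0) / k (z + t • w) (ι t0) := by
        filter_upwards [hc.eventually (Metric.isOpen_ball.mem_nhds hb),
          hkd.continuousAt.eventually_ne h0] with t ht ht'
        have h1 := congrFun (hNf t ht) (ι t0)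
        rw [h1]
        simp only [Pi.smul_apply, smul_eq_mul]
        field_simp
      exact (hNd.div hkd h0).congr_of_eventuallyEq hev
    have hdc : DiffContOnCl ℂ f (Metric.ball 0 r) := by
      refine DifferentiableOn.diffContOnCl fun t ht => ?_
      rw [closure_ball _ hr.ne'] at ht
      exact (hdiff t ht).differentiableWithinAt
    have hfr : ∀ t ∈ frontier (Metric.ball (0 : ℂ) r), ‖f t‖ ≤ C * ‖z - q‖ := by
      intro t ht
      rw [frontier_ball _ hr.ne'] at ht
      have ht' := Metric.sphere_subset_closedBall ht
      have hb := hin z hz2 t ht'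
      have hbq := hin q hqin t ht'
      have e1 : ‖N (z + t • w)‖ ≤ K * ‖z - q‖ := by
        have := hK.dist_le_mul _ (hball _ hb).2.2.2.2.1 _ (hball _ hbq).2.2.2.2.1
        rw [hNz t ht', dist_zero_right, dist_add_right, dist_eq_norm] at this
        exact this
      have e2 : m / 2 ≤ ‖k (z + t • w)‖ := by
        have := hK'.dist_le_mul _ (hball _ hb).2.2.2.2.2 _ (hball _ hbq).2.2.2.2.2
        rw [dist_add_right, dist_eq_norm] at this
        have h3 : dist z q ≤ δ := (Metric.mem_ball.1 hz).le
        have h4 : (K' : ℝ) * dist z q ≤ m / 2 := le_trans (by gcongr) hδm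
        have h5 := hmle t ht
        have h6 := norm_sub_norm_le (k (q + t • w)) (k (z + t • w))
        rw [norm_sub_rev] at h6
        linarith
      have e3 : ‖f t‖ * ‖k (z + t • w)‖ ≤ K * ‖z - q‖ := by
        rw [← norm_smul, ← hNf t hb]; exact e1
      have e4 : ‖f t‖ * (m / 2) ≤ K * ‖z - q‖ := le_trans (by gcongr) e3
      rw [hC, div_mul_eq_mul_div, le_div_iff₀ (by positivity)]
      exact e4
    intro t ht
    have hb := hin z hz2 t ht
    rw [hNf t hb, norm_smul]
    gcongr
    refine Complex.norm_le_of_forall_mem_frontier_norm_le Metric.isBounded_ball hdc hfr ?_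
    rwa [closure_ball _ hr.ne']
  have hall : ∀ z ∈ Metric.ball q δ, ∀ t ∈ Metric.closedBall (0 : ℂ) r,
      ‖N (z + t • w)‖ ≤ C * ‖z - q‖ * ‖k (z + t • w)‖ := by
    intro z hz t ht
    by_contra hcon
    push Not at hcon
    have hz2 : z ∈ Metric.ball q (ρ / 2) := Metric.ball_subset_ball hδρ hz
    have hb := hball _ (hin z hz2 t ht)
    have hc : ContinuousAt (fun z : Cn 4 => z + t • w) z := by fun_prop
    have c1 : ContinuousAt (fun z => ‖N (z + t • w)‖) z :=
      (ContinuousAt.comp (f := fun z : Cn 4 => z + t • w) (g := N) hb.2.2.1.continuousAt hc).norm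
    have c2 : ContinuousAt (fun z => C * ‖z - q‖ * ‖k (z + t • w)‖) z := by
      have := (ContinuousAt.comp (f := fun z : Cn 4 => z + t • w) (g := k)
        hb.2.2.2.1.continuousAt hc).norm
      exact ContinuousAt.mul (by fun_prop) this
    have hev := (c2.eventually_lt c1 hcon).and (Metric.isOpen_ball.mem_nhds hz)
    obtain ⟨O, hO, hOo, hzO⟩ := mem_nhds_iff.1 hev
    obtain ⟨y, hyO, hyG⟩ := (dense_good Z hZ w hw).inter_open_nonempty O hOo ⟨z, hzO⟩
    have h1 := hO hyO
    exact absurd (hgood y h1.2 hyG t ht) (not_le.2 h1.1)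
  refine ⟨C, ?_⟩
  filter_upwards [Metric.ball_mem_nhds (0 : ℂ) hr] with t ht u
  have ht' := Metric.ball_subset_closedBall ht
  have hb := hball _ (hin q hqin t ht')
  have hd : HasFDerivAt N (fderiv ℂ N (q + t • w)) (q + t • w) :=
    hb.2.2.1.differentiableAt.hasFDerivAt
  have hl := (hd.hasLineDerivAt u).tendsto_slope_zero
  have hc : ContinuousAt (fun s : ℂ => q + t • w + s • u) 0 := by fun_prop
  have hk1 : Tendsto (fun s : ℂ => C * ‖u‖ * ‖k (q + t • w + s • u)‖) (𝓝[≠] 0)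
      (𝓝 (C * ‖u‖ * ‖k (q + t • w)‖)) := by
    have h0 : ContinuousAt k (q + t • w + (0 : ℂ) • u) := by simpa using hb.2.2.2.1.continuousAt
    have := (ContinuousAt.comp (f := fun s : ℂ => q + t • w + s • u) (g := k) h0 hc).norm
    have h2 := (this.const_mul (C * ‖u‖)).tendsto
    simp only [Function.comp_apply, zero_smul, add_zero] at h2
    exact h2.mono_left nhdsWithin_le_nhds
  refine le_of_tendsto_of_tendsto hl.norm hk1 ?_
  have hsb : ∀ᶠ s in 𝓝[≠] (0 : ℂ), q + s • u ∈ Metric.ball q δ := by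
    have : ContinuousAt (fun s : ℂ => q + s • u) 0 := by fun_prop
    have hm : Metric.ball q δ ∈ 𝓝 (q + (0:ℂ) • u) := by
      rw [zero_smul, add_zero]
      exact Metric.ball_mem_nhds q hδ
    exact nhdsWithin_le_nhds (this hm)
  filter_upwards [hsb, self_mem_nhdsWithin] with s hs hs0
  have h1 := hall _ hs t ht'
  have e : q + s • u + t • w = q + t • w + s • u := by abel
  rw [e] at h1
  have hs0' : 0 < ‖s‖ := norm_pos_iff.2 hs0
  simp only [hNz t ht', sub_zero, zero_smul, add_zero, norm_smul, norm_inv, add_sub_cancel_left] at h1 ⊢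
  rw [inv_mul_le_iff₀ hs0']
  linarith

/-- The standard determinant on `ℂ⁴`. -/
noncomputable abbrev dt : (Cn 4) [⋀^Fin 4]→ₗ[ℂ] ℂ := (Pi.basisFun ℂ (Fin 4)).det

theorem dt_expand (x y z v : Cn 4) : dt ![x, y, z, v] =
    (x 0 * y 1 - x 1 * y 0) * (z 2 * v 3 - z 3 * v 2)
    - (x 0 * y 2 - x 2 * y 0) * (z 1 * v 3 - z 3 * v 1)
    + (x 0 * y 3 - x 3 * y 0) * (z 1 * v 2 - z 2 * v 1)
    + (x 1 * y 2 - x 2 * y 1) * (z 0 * v 3 - z 3 * v 0)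
    - (x 1 * y 3 - x 3 * y 1) * (z 0 * v 2 - z 2 * v 0)
    + (x 2 * y 3 - x 3 * y 2) * (z 0 * v 1 - z 1 * v 0) := by
  rw [dt, Pi.basisFun_det_apply]
  simp [Matrix.det_succ_row_zero, Fin.sum_univ_succ, Fin.succAbove]
  ring

theorem cramer5 (x y z v T : Cn 4) :
    dt ![x, y, z, v] • T = dt ![T, y, z, v] • x + dt ![x, T, z, v] • y + dt ![x, y, T, v] • z
      + dt ![x, y, z, T] • v := by
  ext i
  simp only [dt_expand, Pi.add_apply, Pi.smul_apply, smul_eq_mul]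
  fin_cases i <;> simp only [Fin.zero_eta, Fin.mk_one, Fin.reduceFinMk] <;> ring

theorem analyticAt_dt {a b c e : Cn 4 → Cn 4} {q : Cn 4} (ha : AnalyticAt ℂ a q)
    (hb : AnalyticAt ℂ b q) (hc : AnalyticAt ℂ c q) (he : AnalyticAt ℂ e q) :
    AnalyticAt ℂ (fun z => dt ![a z, b z, c z, e z]) q := by
  simp only [dt_expand]
  have ha' : ∀ i, AnalyticAt ℂ (fun z => a z i) q := fun i => (analyticAt_pi_iff.1 ha) i
  have hb' : ∀ i, AnalyticAt ℂ (fun z => b z i) q := fun i => (analyticAt_pi_iff.1 hb) i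
  have hc' : ∀ i, AnalyticAt ℂ (fun z => c z i) q := fun i => (analyticAt_pi_iff.1 hc) i
  have he' : ∀ i, AnalyticAt ℂ (fun z => e z i) q := fun i => (analyticAt_pi_iff.1 he) i
  fun_prop (disch := assumption)

theorem continuousAt_dt {E : Type*} [TopologicalSpace E] {a b c e : E → Cn 4} {q : E}
    (ha : ContinuousAt a q)
    (hb : ContinuousAt b q) (hc : ContinuousAt c q) (he : ContinuousAt e q) :
    ContinuousAt (fun z => dt ![a z, b z, c z, e z]) q := by
  simp only [dt_expand]
  have ha' : ∀ i, ContinuousAt (fun z => a z i) q := fun i => (continuousAt_pi.1 ha) i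
  have hb' : ∀ i, ContinuousAt (fun z => b z i) q := fun i => (continuousAt_pi.1 hb) i
  have hc' : ∀ i, ContinuousAt (fun z => c z i) q := fun i => (continuousAt_pi.1 hc) i
  have he' : ∀ i, ContinuousAt (fun z => e z i) q := fun i => (continuousAt_pi.1 he) i
  fun_prop (disch := assumption)

/-- linearity of dt in slots, packaged -/
theorem dt_slot01 (f g h f' g' h' : ℂ) (x y z p : Cn 4) :
    dt ![f • x + g • y + h • z, f' • x + g' • y + h' • z, z, p] =
      (f * g' - g * f') * dt ![x, y, z, p] := by
  simp only [dt_expand, Pi.add_apply, Pi.smul_apply, smul_eq_mul]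
  ring

theorem dt_prop (x y z T v v' : Cn 4) (h : dt ![x, y, z, T] = 0) :
    dt ![T, y, z, v] * dt ![x, y, z, v'] = dt ![T, y, z, v'] * dt ![x, y, z, v] := by
  have h1 := cramer5 x y z v T
  rw [h, zero_smul, add_zero] at h1
  have h2 := congrArg (fun t => dt ![t, y, z, v']) h1
  simp only [dt_expand, Pi.add_apply, Pi.smul_apply, smul_eq_mul] at h2 ⊢
  linear_combination -h2

theorem dt_prop' (x y z T v v' : Cn 4) (h : dt ![x, y, z, T] = 0) :
    dt ![x, T, z, v] * dt ![x, y, z, v'] = dt ![x, T, z, v'] * dt ![x, y, z, v] := by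
  have h1 := cramer5 x y z v T
  rw [h, zero_smul, add_zero] at h1
  have h2 := congrArg (fun t => dt ![x, t, z, v']) h1
  simp only [dt_expand, Pi.add_apply, Pi.smul_apply, smul_eq_mul] at h2 ⊢
  linear_combination -h2

theorem end_continuous (T : Module.End ℂ (Cn 4)) : Continuous T :=
  LinearMap.continuous_of_finiteDimensional T

theorem om_cont {om : Cn 4 → Cn 4 →ₗ[ℂ] ℂ} {d : ℕ} (hom : OmDat om d) (v : Cn 4) :
    Continuous (fun z => om z v) :=
  continuous_iff_continuousAt.2 fun z => (hom.hol v z (mem_univ z)).continuousAt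

/-- at a zero of `T`, the form kills the image of `T` -/
theorem om_ker_im {om : Cn 4 → Cn 4 →ₗ[ℂ] ℂ} {d : ℕ} (hom : OmDat om d)
    (T : Module.End ℂ (Cn 4)) (hT : ∀ z, om z (T z) = 0) (q u : Cn 4) (hq : T q = 0) :
    om q (T u) = 0 := by
  have h1 : ∀ s : ℂ, s ≠ 0 → om (q + s • u) (T u) = 0 := by
    intro s hs
    have := hT (q + s • u)
    rw [map_add, hq, zero_add, map_smul, map_smul, smul_eq_mul] at this
    exact (mul_eq_zero.1 this).resolve_left hs
  have hc : ContinuousAt (fun s : ℂ => om (q + s • u) (T u)) 0 :=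
    ((om_cont hom (T u)).comp (by fun_prop : Continuous fun s : ℂ => q + s • u)).continuousAt
  have h2 : Tendsto (fun s : ℂ => om (q + s • u) (T u)) (𝓝[≠] 0) (𝓝 (om q (T u))) := by
    have := hc.tendsto.mono_left (nhdsWithin_le_nhds (s := {0}ᶜ))
    simpa using this
  refine tendsto_nhds_unique h2 (tendsto_const_nhds.congr' ?_)
  filter_upwards [self_mem_nhdsWithin] with s hs
  exact (h1 s hs).symm

/-- derivative of `dt(T z, Y z, z, e_i)` at a zero of `T` -/
theorem fderiv_dt (N : Cn 4 → Cn 4) (B : Cn 4 → Cn 4 →ₗ[ℂ] Cn 4) (T : Module.End ℂ (Cn 4))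
    (q u : Cn 4) (hq : T q = 0) (hN : DifferentiableAt ℂ N q) (hNB : ∀ z, N z = B z (T z))
    (hB : ContinuousAt (fun z => B z (T u)) q) :
    fderiv ℂ N q u = B q (T u) := by
  have hl := (hN.hasFDerivAt.hasLineDerivAt u).tendsto_slope_zero
  refine tendsto_nhds_unique hl ?_
  have hc : ContinuousAt (fun s : ℂ => q + s • u) 0 := by fun_prop
  have h0 : ContinuousAt (fun z => B z (T u)) (q + (0 : ℂ) • u) := by simpa using hB
  have h2 := (ContinuousAt.comp (f := fun s : ℂ => q + s • u) h0 hc).tendsto.mono_left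
    (nhdsWithin_le_nhds (s := {0}ᶜ))
  simp only [Function.comp_def, zero_smul, add_zero] at h2
  refine h2.congr' ?_
  filter_upwards [self_mem_nhdsWithin] with s hs
  rw [hNB, hNB]
  simp only [map_add, hq, zero_add, map_smul, map_zero, sub_zero, smul_smul]
  rw [inv_mul_cancel₀ hs, one_smul]

theorem est_local {om : Cn 4 → Cn 4 →ₗ[ℂ] ℂ} {d : ℕ} (hom : OmDat om d)
    (T : Module.End ℂ (Cn 4)) (hT : ∀ z, om z (T z) = 0)
    (hZ : dimH {z : Cn 4 | z ≠ 0 ∧ om z = 0} ≤ 4)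
    (q w : Cn 4) (hq0 : q ≠ 0) (hw0 : w ≠ 0) (hq : T q = 0) (hw : T w = 0)
    (X Y : Cn 4 → Cn 4) (hX : AnalyticAt ℂ X q) (hY : AnalyticAt ℂ Y q)
    (hXY : ∀ᶠ z in 𝓝 q, ∀ v, om z v = dt ![X z, Y z, z, v])
    (hne : ∀ᶠ t in 𝓝 (0 : ℂ), t ≠ 0 → om (q + t • w) ≠ 0) (u1 u2 p : Cn 4) :
    ∃ C : ℝ, ∀ᶠ t in 𝓝 (0 : ℂ),
      ‖dt ![T u1, T u2, q + t • w, p]‖ ≤ C * ‖om (q + t • w) p‖ := by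
  let e : Fin 4 → Cn 4 := fun i => Pi.basisFun ℂ (Fin 4) i
  let k : Cn 4 → Cn 4 := fun z i => om z (e i)
  have hk0 : ∀ z, k z = 0 → om z = 0 := fun z hz =>
    (Pi.basisFun ℂ (Fin 4)).ext fun i => congrFun hz i
  let N1 : Cn 4 → Cn 4 := fun z i => dt ![T z, Y z, z, e i]
  let N2 : Cn 4 → Cn 4 := fun z i => dt ![X z, T z, z, e i]
  have hTa : ∀ z, AnalyticAt ℂ (fun z => T z) z := fun z =>
    (LinearMap.toContinuousLinearMap T).analyticAt z
  have hN1 : ∀ z, AnalyticAt ℂ Y z → AnalyticAt ℂ N1 z := fun z hY => analyticAt_pi_iff.2 fun i =>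
    analyticAt_dt (hTa z) hY analyticAt_id analyticAt_const
  have hN2 : ∀ z, AnalyticAt ℂ X z → AnalyticAt ℂ N2 z := fun z hX => analyticAt_pi_iff.2 fun i =>
    analyticAt_dt hX (hTa z) analyticAt_id analyticAt_const
  have hka : AnalyticAt ℂ k q := analyticAt_pi_iff.2 fun i => hom.hol _ q (mem_univ q)
  have hTw : ∀ t : ℂ, T (q + t • w) = 0 := by
    intro t
    rw [map_add, map_smul, hq, hw, smul_zero, add_zero]
  have hkw : ∀ᶠ t in 𝓝 (0 : ℂ), t ≠ 0 → k (q + t • w) ≠ 0 := by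
    filter_upwards [hne] with t ht ht0 h0
    exact ht ht0 (hk0 _ h0)
  have hkZ : ∀ᶠ z in 𝓝 q, k z = 0 → z ∈ {z : Cn 4 | z ≠ 0 ∧ om z = 0} := by
    filter_upwards [continuousAt_id.eventually_ne hq0] with z hz h0
    exact ⟨hz, hk0 z h0⟩
  have hz0 : ∀ y z v : Cn 4, dt ![0, y, z, v] = 0 := fun y z v => by rw [dt_expand]; simp
  have hz1 : ∀ y z v : Cn 4, dt ![y, 0, z, v] = 0 := fun y z v => by rw [dt_expand]; simp
  obtain ⟨C1, h1⟩ := hartogs_bound N1 k q w _ hZ (hN1 q hY) hka hw0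
    (by
      filter_upwards [hXY] with z hz i j
      simp only [N1, k, hz]
      exact dt_prop _ _ _ _ _ _ (by rw [← hz, hT])) hkZ hkw
    (Eventually.of_forall fun t => by ext i; simp only [N1, hTw, hz0]; rfl)
  obtain ⟨C2, h2⟩ := hartogs_bound N2 k q w _ hZ (hN2 q hX) hka hw0
    (by
      filter_upwards [hXY] with z hz i j
      simp only [N2, k, hz]
      exact dt_prop' _ _ _ _ _ _ (by rw [← hz, hT])) hkZ hkw
    (Eventually.of_forall fun t => by ext i; simp only [N2, hTw, hz1]; rfl)
  choose B1 hB1 using fun z i => det_lin0 dt (Y z) z (e i)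
  choose B2 hB2 using fun z i => det_lin1 dt (X z) z (e i)
  have hcw : ContinuousAt (fun t : ℂ => q + t • w) 0 := by fun_prop
  have hcw' : Tendsto (fun t : ℂ => q + t • w) (𝓝 0) (𝓝 q) := by simpa using hcw.tendsto
  refine ⟨C1 * ‖u1‖ * (C2 * ‖u2‖) + (C2 * ‖u1‖) * (C1 * ‖u2‖), ?_⟩
  set C := C1 * ‖u1‖ * (C2 * ‖u2‖) + (C2 * ‖u1‖) * (C1 * ‖u2‖) with hC
  have main : ∀ᶠ t in 𝓝 (0 : ℂ), t ≠ 0 →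
      ‖dt ![T u1, T u2, q + t • w, p]‖ ≤ C * ‖om (q + t • w) p‖ := by
    filter_upwards [h1, h2, hkw, hcw'.eventually hXY, hcw'.eventually hX.eventually_analyticAt,
      hcw'.eventually hY.eventually_analyticAt] with t h1 h2 hk hXY hX hY ht0
    specialize hk ht0
    set z := q + t • w with hz
    have hTz : T z = 0 := hTw t
    have f1 : ∀ u, fderiv ℂ N1 z u = fun i => dt ![T u, Y z, z, e i] := by
      intro u
      have := fderiv_dt N1 (fun z => LinearMap.pi (B1 z)) T z u hTz (hN1 z hY).differentiableAt
        (fun z => by ext i; simp [hB1, N1]) (by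
          refine continuousAt_pi.2 fun i => ?_
          simp only [LinearMap.pi_apply, hB1]
          exact continuousAt_dt continuousAt_const hY.continuousAt continuousAt_id continuousAt_const)
      rw [this]; ext i; simp [hB1]
    have f2 : ∀ u, fderiv ℂ N2 z u = fun i => dt ![X z, T u, z, e i] := by
      intro u
      have := fderiv_dt N2 (fun z => LinearMap.pi (B2 z)) T z u hTz (hN2 z hX).differentiableAt
        (fun z => by ext i; simp [hB2, N2]) (by
          refine continuousAt_pi.2 fun i => ?_
          simp only [LinearMap.pi_apply, hB2]
          exact continuousAt_dt hX.continuousAt continuousAt_const continuousAt_id continuousAt_const)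
      rw [this]; ext i; simp [hB2]
    obtain ⟨i, hi⟩ := Finite.exists_max (fun i => ‖k z i‖)
    have hki : ‖k z‖ = ‖k z i‖ :=
      le_antisymm ((pi_norm_le_iff_of_nonneg (norm_nonneg _)).2 hi) (norm_le_pi_norm _ i)
    have hkpos : 0 < ‖k z i‖ := by rw [← hki]; exact norm_pos_iff.2 hk
    have b1 : ∀ u, ‖dt ![T u, Y z, z, e i]‖ ≤ C1 * ‖u‖ * ‖k z i‖ := by
      intro u
      have := h1 u
      rw [f1, hki] at this
      exact (norm_le_pi_norm (fun i => dt ![T u, Y z, z, e i]) i).trans this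
    have b2 : ∀ u, ‖dt ![X z, T u, z, e i]‖ ≤ C2 * ‖u‖ * ‖k z i‖ := by
      intro u
      have := h2 u
      rw [f2, hki] at this
      exact (norm_le_pi_norm (fun i => dt ![X z, T u, z, e i]) i).trans this
    have hcr : ∀ u, k z i • T u = dt ![T u, Y z, z, e i] • X z + dt ![X z, T u, z, e i] • Y z
        + dt ![X z, Y z, T u, e i] • z := by
      intro u
      have c := cramer5 (X z) (Y z) z (e i) (T u)
      rw [← hXY (T u), om_ker_im hom T hT z u hTz, zero_smul, add_zero, ← hXY] at c
      exact c
    have key : k z i ^ 2 * dt ![T u1, T u2, z, p] = (dt ![T u1, Y z, z, e i] * dt ![X z, T u2, z, e i]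
        - dt ![X z, T u1, z, e i] * dt ![T u2, Y z, z, e i]) * om z p := by
      rw [hXY, ← dt_slot01 _ _ (dt ![X z, Y z, T u1, e i]) _ _ (dt ![X z, Y z, T u2, e i]),
        ← hcr, ← hcr]
      simp only [dt_expand, Pi.smul_apply, smul_eq_mul]
      ring
    have key2 := congrArg norm key
    rw [norm_mul, norm_mul, norm_pow] at key2
    have n1 : ‖dt ![T u1, Y z, z, e i] * dt ![X z, T u2, z, e i]‖ ≤
        (C1 * ‖u1‖ * ‖k z i‖) * (C2 * ‖u2‖ * ‖k z i‖) := by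
      rw [norm_mul]
      exact mul_le_mul (b1 u1) (b2 u2) (norm_nonneg _) ((norm_nonneg _).trans (b1 u1))
    have n2 : ‖dt ![X z, T u1, z, e i] * dt ![T u2, Y z, z, e i]‖ ≤
        (C2 * ‖u1‖ * ‖k z i‖) * (C1 * ‖u2‖ * ‖k z i‖) := by
      rw [norm_mul]
      exact mul_le_mul (b2 u1) (b1 u2) (norm_nonneg _) ((norm_nonneg _).trans (b2 u1))
    have n3 := (norm_sub_le (dt ![T u1, Y z, z, e i] * dt ![X z, T u2, z, e i])
      (dt ![X z, T u1, z, e i] * dt ![T u2, Y z, z, e i])).trans (add_le_add n1 n2)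
    have n4 : ‖k z i‖ ^ 2 * ‖dt ![T u1, T u2, z, p]‖ ≤ ‖k z i‖ ^ 2 * (C * ‖om z p‖) := by
      rw [key2]
      refine (mul_le_mul_of_nonneg_right n3 (norm_nonneg _)).trans (le_of_eq ?_)
      rw [hC]; ring
    exact le_of_mul_le_mul_left n4 (by positivity)
  have h0 : ‖dt ![T u1, T u2, q + (0 : ℂ) • w, p]‖ ≤ C * ‖om (q + (0 : ℂ) • w) p‖ := by
    have c1 : ContinuousAt (fun t : ℂ => ‖dt ![T u1, T u2, q + t • w, p]‖) 0 :=
      (continuousAt_dt continuousAt_const continuousAt_const hcw continuousAt_const).norm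
    have c2 : ContinuousAt (fun t : ℂ => C * ‖om (q + t • w) p‖) 0 :=
      (((om_cont hom p).comp (by fun_prop : Continuous fun t : ℂ => q + t • w)).norm.continuousAt).const_mul C
    refine le_of_tendsto_of_tendsto (c1.tendsto.mono_left (nhdsWithin_le_nhds (s := {0}ᶜ)))
      (c2.tendsto.mono_left nhdsWithin_le_nhds) ?_
    exact (eventually_nhdsWithin_iff).2 main
  filter_upwards [main] with t ht
  by_cases ht0 : t = 0
  · rw [ht0]; exact h0
  · exact ht ht0

theorem om_poly {om : Cn 4 → Cn 4 →ₗ[ℂ] ℂ} {d : ℕ} (hom : OmDat om d) (v : Cn 4) :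
    ∃ W : P4, ∀ z, om z v = MvPolynomial.eval z W :=
  homog_poly (fun z => om z v) (d + 1) (hom.hol v 0 (mem_univ _)) fun t z => hom.homog t z v

theorem om_line {om : Cn 4 → Cn 4 →ₗ[ℂ] ℂ} {d : ℕ} (hom : OmDat om d) (v q w : Cn 4) :
    ∃ P : Polynomial ℂ, ∀ t : ℂ, om (q + t • w) v = P.eval t := by
  obtain ⟨W, hW⟩ := om_poly hom v
  refine ⟨MvPolynomial.aeval (fun i => Polynomial.C (q i) + Polynomial.X * Polynomial.C (w i)) W,
    fun t => ?_⟩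
  rw [hW]
  have h := MvPolynomial.map_aeval
    (fun i => Polynomial.C (q i) + Polynomial.X * Polynomial.C (w i)) (Polynomial.evalRingHom t) W
  rw [Polynomial.coe_evalRingHom] at h
  rw [h, MvPolynomial.coe_eval₂Hom, MvPolynomial.eval, MvPolynomial.coe_eval₂Hom]
  congr 1
  · ext; simp
  · ext i; simp; ring

theorem om_ne_line {om : Cn 4 → Cn 4 →ₗ[ℂ] ℂ} {d : ℕ} (hom : OmDat om d) (q w : Cn 4)
    (z0 : Cn 4) (hz0 : om z0 ≠ 0) (hz : ∃ a b : ℂ, z0 = a • q + b • w) :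
    ∀ᶠ t in 𝓝 (0 : ℂ), t ≠ 0 → om (q + t • w) ≠ 0 := by
  obtain ⟨a, b, hab⟩ := hz
  obtain ⟨v, hv⟩ : ∃ v, om z0 v ≠ 0 := by
    by_contra h
    push Not at h
    exact hz0 (LinearMap.ext h)
  obtain ⟨P, hP⟩ := om_line hom v q w
  have hP0 : P ≠ 0 := by
    rintro rfl
    simp only [Polynomial.eval_zero] at hP
    have h1 : ∀ s : ℂ, s ≠ 0 → om (s • q + b • w) v = 0 := by
      intro s hs
      have : s • q + b • w = s • (q + (b / s) • w) := by
        rw [smul_add, smul_smul, mul_div_cancel₀ _ hs]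
      rw [this, hom.homog, hP, mul_zero]
    have hc : Continuous (fun s : ℂ => om (s • q + b • w) v) :=
      (om_cont hom v).comp (by fun_prop)
    have h2 : (fun s : ℂ => om (s • q + b • w) v) = fun _ => 0 := by
      refine Continuous.ext_on (dense_compl_singleton (0 : ℂ)) hc continuous_const ?_
      intro s hs
      exact h1 s hs
    exact hv (by rw [hab]; exact congrFun h2 a)
  have hf : ({t | P.IsRoot t} \ {0} : Set ℂ).Finite := (P.finite_setOfPred_isRoot hP0).sdiff
  filter_upwards [hf.isClosed.isOpen_compl.mem_nhds (by simp : (0 : ℂ) ∈ _)] with t ht ht0 h0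
  refine ht ⟨?_, ht0⟩
  rw [Set.mem_ofPred_eq, Polynomial.IsRoot, ← hP, h0]
  rfl

/-- **Vanishing lemma.** -/
theorem om_vanish {om : Cn 4 → Cn 4 →ₗ[ℂ] ℂ} {d : ℕ} (hom : OmDat om d) (hd : 1 ≤ d)
    (T : Module.End ℂ (Cn 4)) (hT : ∀ z, om z (T z) = 0)
    (hZ : dimH {z : Cn 4 | z ≠ 0 ∧ om z = 0} ≤ 4)
    (hfree : ∀ q : Cn 4, q ≠ 0 → ∃ X Y : Cn 4 → Cn 4, AnalyticAt ℂ X q ∧ AnalyticAt ℂ Y q ∧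
      ∀ᶠ z in 𝓝 q, ∀ v, om z v = dt ![X z, Y z, z, v])
    (hker : Module.finrank ℂ (LinearMap.ker T) = 2) (hT2 : T * T ≠ 0) :
    ∀ z, T z = 0 → om z = 0 := by
  have hL : ∀ q1 q2 : Cn 4, T q1 = 0 → T q2 = 0 → LinearIndependent ℂ ![q1, q2] →
      ∀ z, T z = 0 → ∃ a b : ℂ, z = a • q1 + b • q2 := by
    intro q1 q2 h1 h2 hli z hz
    have hle : Submodule.span ℂ (Set.range ![q1, q2]) ≤ LinearMap.ker T := by
      rw [Submodule.span_le]
      rintro _ ⟨i, rfl⟩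
      fin_cases i
      · exact h1
      · exact h2
    have heq := Submodule.eq_of_le_of_finrank_eq hle (by
      rw [finrank_span_eq_card hli, hker]; rfl)
    have hz' : z ∈ Submodule.span ℂ (Set.range ![q1, q2]) := by rw [heq]; exact hz
    rw [Matrix.range_cons, Matrix.range_cons, Matrix.range_empty, Set.union_empty,
      Set.singleton_union, Submodule.mem_span_pair] at hz'
    obtain ⟨a, b, hab⟩ := hz'
    exact ⟨a, b, hab.symm⟩
  have hrange : Module.finrank ℂ (LinearMap.range T) = 2 := by
    have := LinearMap.finrank_range_add_finrank_ker T
    rw [hker] at this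
    simp at this
    omega
  -- a kernel vector outside the image
  obtain ⟨q0, hq0, hq0im⟩ : ∃ q0, T q0 = 0 ∧ q0 ∉ LinearMap.range T := by
    by_contra hcon
    push Not at hcon
    have hle : LinearMap.ker T ≤ LinearMap.range T := fun z hz => hcon z hz
    have heq := Submodule.eq_of_le_of_finrank_eq hle (by rw [hker, hrange])
    apply hT2
    refine LinearMap.ext fun z => ?_
    have : T z ∈ LinearMap.ker T := by rw [heq]; exact ⟨z, rfl⟩
    exact this
  obtain ⟨u1, u2, hu⟩ : ∃ u1 u2, LinearIndependent ℂ ![T u1, T u2] := by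
    let b := Module.finBasisOfFinrankEq ℂ _ hrange
    obtain ⟨u1, hu1⟩ := (b 0).2
    obtain ⟨u2, hu2⟩ := (b 1).2
    refine ⟨u1, u2, ?_⟩
    have := b.linearIndependent.map' (LinearMap.range T).subtype (Submodule.ker_subtype _)
    have e : ![T u1, T u2] = (LinearMap.range T).subtype ∘ b := by
      ext i : 1
      fin_cases i
      · exact hu1
      · exact hu2
    rw [e]
    exact this
  have hq00 : q0 ≠ 0 := fun h => hq0im (by rw [h]; exact Submodule.zero_mem _)
  obtain ⟨p, hp⟩ : ∃ p, dt ![T u1, T u2, q0, p] ≠ 0 := by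
    have h3 : LinearIndependent ℂ ![T u1, T u2, q0] := by
      have hsp : Submodule.span ℂ (Set.range ![T u1, T u2]) ≤ LinearMap.range T := by
        rw [Submodule.span_le]
        rintro _ ⟨i, rfl⟩
        fin_cases i
        · exact ⟨u1, rfl⟩
        · exact ⟨u2, rfl⟩
      have := linearIndependent_finSnoc.2 ⟨hu, fun h => hq0im (hsp h)⟩
      have e : ![T u1, T u2, q0] = Fin.snoc (α := fun _ => Cn 4) ![T u1, T u2] q0 := by
        ext i : 1
        fin_cases i <;> rfl
      rw [e]
      exact this
    obtain ⟨p, hp⟩ : ∃ p, p ∉ Submodule.span ℂ (Set.range ![T u1, T u2, q0]) := by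
      by_contra hcon
      push Not at hcon
      have htop : Submodule.span ℂ (Set.range ![T u1, T u2, q0]) = ⊤ :=
        Submodule.eq_top_iff'.2 hcon
      have := finrank_span_eq_card h3
      rw [htop, finrank_top] at this
      simp at this
    refine ⟨p, ?_⟩
    have h4 : LinearIndependent ℂ ![T u1, T u2, q0, p] := by
      have := linearIndependent_finSnoc.2 ⟨h3, hp⟩
      have e : ![T u1, T u2, q0, p] = Fin.snoc (α := fun _ => Cn 4) ![T u1, T u2, q0] p := by
        ext i : 1
        fin_cases i <;> rfl
      rw [e]
      exact this
    let bb := basisOfLinearIndependentOfCardEqFinrank h4 (by simp)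
    have := (Pi.basisFun ℂ (Fin 4)).isUnit_det bb
    rw [coe_basisOfLinearIndependentOfCardEqFinrank] at this
    exact this.ne_zero
  obtain ⟨ℓ, hℓ⟩ := det_lin2 dt (T u1) (T u2) p
  obtain ⟨q1, hq1, hq10, hℓ1⟩ : ∃ q1, T q1 = 0 ∧ q1 ≠ 0 ∧ ℓ q1 = 0 := by
    obtain ⟨x, hx, hxq⟩ : ∃ x, T x = 0 ∧ x ∉ Submodule.span ℂ {q0} := by
      by_contra hcon
      push Not at hcon
      have hle : LinearMap.ker T ≤ Submodule.span ℂ {q0} := fun z hz => hcon z hz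
      have := Submodule.finrank_mono hle
      rw [hker, finrank_span_singleton hq00] at this
      omega
    have hℓ0 : ℓ q0 ≠ 0 := by rw [hℓ]; exact hp
    refine ⟨x - (ℓ x / ℓ q0) • q0, ?_, ?_, ?_⟩
    · rw [map_sub, map_smul, hx, hq0, smul_zero, sub_zero]
    · intro h
      exact hxq (by rw [sub_eq_zero.1 h]; exact Submodule.smul_mem _ _ (Submodule.mem_span_singleton_self _))
    · rw [map_sub, map_smul, smul_eq_mul, div_mul_cancel₀ _ hℓ0, sub_self]
  have hℓ0 : ℓ q0 ≠ 0 := by rw [hℓ]; exact hp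
  have hli : ∀ s : ℂ, LinearIndependent ℂ ![q0 + s • q1, q1] := by
    intro s
    rw [LinearIndependent.pair_iff]
    intro a b hab
    have h1 := congrArg ℓ hab
    simp only [map_add, map_smul, hℓ1, mul_zero, add_zero, map_zero, smul_eq_mul] at h1
    have ha : a = 0 := (mul_eq_zero.1 h1).resolve_right hℓ0
    rw [ha, zero_smul, zero_add] at hab
    exact ⟨ha, (smul_eq_zero.1 hab).resolve_right hq10⟩
  by_contra hcon
  push Not at hcon
  obtain ⟨z0, hz0, hz0om⟩ := hcon
  have hest : ∀ q w, T q = 0 → T w = 0 → q ≠ 0 → w ≠ 0 → LinearIndependent ℂ ![q, w] →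
      ∃ C : ℝ, ∀ᶠ t in 𝓝 (0 : ℂ), ‖ℓ (q + t • w)‖ ≤ C * ‖om (q + t • w) p‖ := by
    intro q w hq hw hq0 hw0 hli
    obtain ⟨X, Y, hX, hY, hXY⟩ := hfree q hq0
    obtain ⟨C, hC⟩ := est_local hom T hT hZ q w hq0 hw0 hq hw X Y hX hY hXY
      (om_ne_line hom q w z0 hz0om (hL q w hq hw hli z0 hz0)) u1 u2 p
    exact ⟨C, by simpa only [hℓ] using hC⟩
  obtain ⟨P, hP⟩ := om_line hom p q0 q1
  have hroot : ∀ s, P.eval s ≠ 0 := by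
    intro s hs
    have hne : q0 + s • q1 ≠ 0 := by
      intro h
      have := congrArg ℓ h
      rw [map_add, map_smul, hℓ1, smul_zero, add_zero, map_zero] at this
      exact hℓ0 this
    obtain ⟨C, hC⟩ := hest (q0 + s • q1) q1 (by rw [map_add, map_smul, hq0, hq1]; simp) hq1 hne
      hq10 (hli s)
    have := hC.self_of_nhds
    rw [zero_smul, add_zero, hP, hs, norm_zero, mul_zero, map_add, map_smul, hℓ1, smul_zero,
      add_zero] at this
    exact hℓ0 (norm_le_zero_iff.1 this)
  have hdeg : P.degree = 0 := by
    by_contra h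
    obtain ⟨s, hs⟩ := IsAlgClosed.exists_root P h
    exact hroot s hs
  rw [Polynomial.eq_C_of_degree_eq_zero hdeg] at hP
  set κ := P.coeff 0
  simp only [Polynomial.eval_C] at hP
  obtain ⟨C, hC⟩ := hest q1 q0 hq1 hq0 hq10 hq00 (by
    have := hli 0
    rw [zero_smul, add_zero] at this
    exact LinearIndependent.pair_symm_iff.1 this)
  have hlim : ∀ᶠ t in 𝓝[≠] (0 : ℂ), ‖ℓ q0‖ ≤ C * ‖κ‖ * ‖t‖ ^ d := by
    filter_upwards [hC.filter_mono nhdsWithin_le_nhds, self_mem_nhdsWithin] with t ht ht0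
    have ht0 : t ≠ 0 := ht0
    have e1 : q1 + t • q0 = t • (q0 + t⁻¹ • q1) := by
      rw [smul_add, smul_smul, mul_inv_cancel₀ ht0, one_smul, add_comm]
    rw [e1, hom.homog, hP, map_smul, map_add, map_smul, hℓ1, smul_zero, add_zero, smul_eq_mul,
      norm_mul, norm_mul, norm_pow] at ht
    have htp : 0 < ‖t‖ := norm_pos_iff.2 ht0
    refine le_of_mul_le_mul_left (ht.trans (le_of_eq ?_)) htp
    ring
  have hten : Tendsto (fun t : ℂ => C * ‖κ‖ * ‖t‖ ^ d) (𝓝[≠] 0) (𝓝 0) := by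
    have : Continuous (fun t : ℂ => C * ‖κ‖ * ‖t‖ ^ d) := by fun_prop
    have h := this.tendsto 0
    rw [norm_zero, zero_pow (by omega), mul_zero] at h
    exact h.mono_left nhdsWithin_le_nhds
  have := ge_of_tendsto hten hlim
  exact hℓ0 (norm_le_zero_iff.1 this)

theorem bdet_expand (b : Module.Basis (Fin 4) ℂ (Cn 4)) (x y z v : Cn 4) :
    b.det ![x, y, z, v] =
    (b.coord 0 x * b.coord 1 y - b.coord 1 x * b.coord 0 y) *
      (b.coord 2 z * b.coord 3 v - b.coord 3 z * b.coord 2 v)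
    - (b.coord 0 x * b.coord 2 y - b.coord 2 x * b.coord 0 y) *
      (b.coord 1 z * b.coord 3 v - b.coord 3 z * b.coord 1 v)
    + (b.coord 0 x * b.coord 3 y - b.coord 3 x * b.coord 0 y) *
      (b.coord 1 z * b.coord 2 v - b.coord 2 z * b.coord 1 v)
    + (b.coord 1 x * b.coord 2 y - b.coord 2 x * b.coord 1 y) *
      (b.coord 0 z * b.coord 3 v - b.coord 3 z * b.coord 0 v)
    - (b.coord 1 x * b.coord 3 y - b.coord 3 x * b.coord 1 y) *
      (b.coord 0 z * b.coord 2 v - b.coord 2 z * b.coord 0 v)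
    + (b.coord 2 x * b.coord 3 y - b.coord 3 x * b.coord 2 y) *
      (b.coord 0 z * b.coord 1 v - b.coord 1 z * b.coord 0 v) := by
  rw [Module.Basis.det_apply]
  simp [Matrix.det_succ_row_zero, Fin.sum_univ_succ, Fin.succAbove, Module.Basis.toMatrix_apply]
  ring

theorem fin2 {om : Cn 4 → Cn 4 →ₗ[ℂ] ℂ} {d : ℕ} (hom : OmDat om d)
    (b : Module.Basis (Fin 4) ℂ (Cn 4)) (X1 : Cn 4 → Cn 4) (d1 : ℕ) (hd : d1 ≤ d)
    (hX : AnalyticOnNhd ℂ X1 univ) (hX1 : ∀ (t : ℂ) z, X1 (t • z) = t ^ d1 • X1 z)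
    (l y W : Fin 4 → P4) (hl : ∀ z j, MvPolynomial.eval z (l j) = b.coord j (X1 z))
    (hy : ∀ z j, MvPolynomial.eval z (y j) = b.coord j z)
    (hW : ∀ z j, om z (b j) = MvPolynomial.eval z (W j)) (Y0 Y1 Y2 Y3 : P4)
    (h0 : W 0 = -(l 1 * (Y2 * y 3 - Y3 * y 2) - l 2 * (Y1 * y 3 - Y3 * y 1)
      + l 3 * (Y1 * y 2 - Y2 * y 1)))
    (h1 : W 1 = l 0 * (Y2 * y 3 - Y3 * y 2) - l 2 * (Y0 * y 3 - Y3 * y 0)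
      + l 3 * (Y0 * y 2 - Y2 * y 0))
    (h2 : W 2 = -(l 0 * (Y1 * y 3 - Y3 * y 1) - l 1 * (Y0 * y 3 - Y3 * y 0)
      + l 3 * (Y0 * y 1 - Y1 * y 0)))
    (h3 : W 3 = l 0 * (Y1 * y 2 - Y2 * y 1) - l 1 * (Y0 * y 2 - Y2 * y 0)
      + l 2 * (Y0 * y 1 - Y1 * y 0)) : OmSplits om := by
  refine om_finish hom b X1 d1 hd hX hX1 ![Y0, Y1, Y2, Y3] fun z i => ?_
  have hc : ∀ j, b.coord j (∑ j, MvPolynomial.eval z (![Y0, Y1, Y2, Y3] j) • b j) =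
      MvPolynomial.eval z (![Y0, Y1, Y2, Y3] j) := by
    intro j
    rw [Module.Basis.coord_apply, Module.Basis.repr_sum_self]
  rw [bdet_expand]
  simp only [hc, ← hl z, ← hy z]
  rw [hW]
  fin_cases i
  · simp [h0, Module.Basis.repr_self, Finsupp.single_apply, -map_sum]; ring
  · simp [h1, Module.Basis.repr_self, Finsupp.single_apply, -map_sum]; ring
  · simp [h2, Module.Basis.repr_self, Finsupp.single_apply, -map_sum]; ring
  · simp [h3, Module.Basis.repr_self, Finsupp.single_apply, -map_sum]; ring

theorem surj_pi {k : ℕ} (φ : Fin k → (Cn 4 →ₗ[ℂ] ℂ)) (U : Submodule ℂ (Cn 4))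
    (hU : Module.finrank ℂ U + k ≤ 4) (h : ∀ z, (∀ i, φ i z = 0) → z ∈ U) :
    Function.Surjective (LinearMap.pi φ) := by
  rw [← LinearMap.range_eq_top]
  apply Submodule.eq_top_of_finrank_eq
  have h1 := LinearMap.finrank_range_add_finrank_ker (LinearMap.pi φ)
  have h2 : LinearMap.ker (LinearMap.pi φ) ≤ U := by
    intro z hz
    refine h z fun i => ?_
    exact congrFun (LinearMap.mem_ker.1 hz) i
  have h3 := Submodule.finrank_mono h2
  have h4 := (LinearMap.range (LinearMap.pi φ)).finrank_le
  simp at h1 h4 ⊢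
  omega

theorem ext_li {k : ℕ} (v : Fin k → Cn 4) (hv : LinearIndependent ℂ v) (H : Submodule ℂ (Cn 4))
    (hk : k < Module.finrank ℂ H) : ∃ h ∈ H, LinearIndependent ℂ (Fin.cons h v : Fin (k + 1) → Cn 4) := by
  obtain ⟨h, hh, hn⟩ : ∃ h ∈ H, h ∉ Submodule.span ℂ (Set.range v) := by
    by_contra hcon
    push Not at hcon
    have hle : H ≤ Submodule.span ℂ (Set.range v) := hcon
    have := Submodule.finrank_mono hle
    rw [finrank_span_eq_card hv, Fintype.card_fin] at this
    omega
  exact ⟨h, hh, linearIndependent_finCons.2 ⟨hv, hn⟩⟩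

theorem mem_flag (b : Module.Basis (Fin 4) ℂ (Cn 4)) {k : ℕ} (f : Fin k → Fin 4)
    (hf : Function.Injective f) (U : Submodule ℂ (Cn 4)) (hU : Module.finrank ℂ U = k)
    (h : ∀ j, b (f j) ∈ U) (z : Cn 4) (hz : z ∈ U) (i : Fin 4) (hi : ∀ j, f j ≠ i) :
    b.coord i z = 0 := by
  have hli : LinearIndependent ℂ (b ∘ f) := b.linearIndependent.comp f hf
  have hle : Submodule.span ℂ (Set.range (b ∘ f)) ≤ U := by
    rw [Submodule.span_le]
    rintro _ ⟨j, rfl⟩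
    exact h j
  have heq := Submodule.eq_of_le_of_finrank_eq hle (by
    rw [finrank_span_eq_card hli, Fintype.card_fin, hU])
  have hle2 : Submodule.span ℂ (Set.range (b ∘ f)) ≤ LinearMap.ker (b.coord i) := by
    rw [Submodule.span_le]
    rintro _ ⟨j, rfl⟩
    simp [Module.Basis.repr_self, Finsupp.single_apply, hi j]
  rw [heq] at hle2
  exact hle2 hz

theorem sum_four (b : Module.Basis (Fin 4) ℂ (Cn 4)) (z : Cn 4) :
    z = b.coord 0 z • b 0 + b.coord 1 z • b 1 + b.coord 2 z • b 2 + b.coord 3 z • b 3 := by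
  conv_lhs => rw [← b.sum_repr z]
  rw [Fin.sum_univ_four]
  rfl

theorem flag_of_li (v : Fin 4 → Cn 4) (hv : LinearIndependent ℂ v) :
    ∃ b : Module.Basis (Fin 4) ℂ (Cn 4), ∀ i, b i = v i :=
  ⟨basisOfLinearIndependentOfCardEqFinrank hv (by simp), fun i => by simp⟩

theorem flag2 (U H : Submodule ℂ (Cn 4)) (hU : Module.finrank ℂ U = 2)
    (hH : 3 ≤ Module.finrank ℂ H) :
    ∃ b : Module.Basis (Fin 4) ℂ (Cn 4), b 1 ∈ H ∧ b 2 ∈ U ∧ b 3 ∈ U ∧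
      ∀ z ∈ U, b.coord 0 z = 0 ∧ b.coord 1 z = 0 := by
  let c := Module.finBasisOfFinrankEq ℂ _ hU
  have hc : LinearIndependent ℂ (U.subtype ∘ c) :=
    c.linearIndependent.map' U.subtype (Submodule.ker_subtype _)
  obtain ⟨h, hh, h1⟩ := ext_li _ hc H (by omega)
  obtain ⟨p, -, h2⟩ := ext_li _ h1 ⊤ (by simp)
  obtain ⟨b, hb⟩ := flag_of_li _ h2
  have b1 : b 1 = h := hb 1
  have b2 : b 2 = c 0 := hb 2
  have b3 : b 3 = c 1 := hb 3
  have m2 : b 2 ∈ U := by rw [b2]; exact (c 0).2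
  have m3 : b 3 ∈ U := by rw [b3]; exact (c 1).2
  refine ⟨b, by rw [b1]; exact hh, m2, m3, fun z hz => ?_⟩
  have := mem_flag b ![2, 3] (by decide) U hU (by
    intro j
    fin_cases j
    · exact m2
    · exact m3) z hz
  exact ⟨this 0 (by decide), this 1 (by decide)⟩

theorem flag1 (p : Cn 4) (hp : p ≠ 0) : ∃ b : Module.Basis (Fin 4) ℂ (Cn 4), b 3 = p := by
  have h0 : LinearIndependent ℂ (fun _ : Fin 1 => p) := linearIndependent_unique_iff.2 hp
  obtain ⟨h, -, h1⟩ := ext_li _ h0 ⊤ (by simp)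
  obtain ⟨h, -, h2⟩ := ext_li _ h1 ⊤ (by simp)
  obtain ⟨h, -, h3⟩ := ext_li _ h2 ⊤ (by simp)
  obtain ⟨b, hb⟩ := flag_of_li _ h3
  exact ⟨b, hb 3⟩

theorem om_polys {om : Cn 4 → Cn 4 →ₗ[ℂ] ℂ} {d : ℕ} (hom : OmDat om d)
    (b : Module.Basis (Fin 4) ℂ (Cn 4)) :
    ∃ W : Fin 4 → P4, ∀ z j, om z (b j) = MvPolynomial.eval z (W j) := by
  choose W hW using fun j => om_poly hom (b j)
  exact ⟨W, fun z j => hW j z⟩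

theorem om_coords (om : Cn 4 → Cn 4 →ₗ[ℂ] ℂ) (b : Module.Basis (Fin 4) ℂ (Cn 4)) (z x : Cn 4) :
    om z x = b.coord 0 x * om z (b 0) + b.coord 1 x * om z (b 1) + b.coord 2 x * om z (b 2)
      + b.coord 3 x * om z (b 3) := by
  conv_lhs => rw [sum_four b x]
  simp only [map_add, map_smul, smul_eq_mul]

theorem case_A {om : Cn 4 → Cn 4 →ₗ[ℂ] ℂ} {d : ℕ} (hom : OmDat om d)
    (T : Module.End ℂ (Cn 4)) (hT : ∀ z, om z (T z) = 0)
    (hker : Module.finrank ℂ (LinearMap.ker T) = 3) : OmSplits om := by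
  have hr : Module.finrank ℂ (LinearMap.range T) = 1 := by
    have := LinearMap.finrank_range_add_finrank_ker T
    rw [hker] at this
    simp at this
    omega
  obtain ⟨⟨p, hpr⟩, hp, hp1⟩ := finrank_eq_one_iff'.1 hr
  obtain ⟨b, hb⟩ := flag1 p (fun h => hp (by simp [h]))
  obtain ⟨u, hu⟩ := hpr
  have hTz : ∀ z, T z = b.coord 3 (T z) • b 3 := by
    intro z
    obtain ⟨c, hc⟩ := hp1 ⟨T z, z, rfl⟩
    have hc' : c • p = T z := congrArg Subtype.val hc
    rw [← hc', ← hb]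
    simp
  obtain ⟨W, hW⟩ := om_polys hom b
  have hy : ∀ z j, MvPolynomial.eval z (linP (b.coord j)) = b.coord j z := fun z j => eval_linP _ z
  -- W 3 = 0
  have h3 : W 3 = 0 := by
    have hm : linP (b.coord 3 ∘ₗ T) * W 3 = 0 := p4_ext fun z => by
      rw [map_mul, eval_linP, ← hW, map_zero]
      have := hT z
      rw [hTz z, map_smul] at this
      exact this
    refine (mul_eq_zero.1 hm).resolve_left fun h0 => ?_
    have := eval_linP (b.coord 3 ∘ₗ T) u
    rw [h0, map_zero, LinearMap.comp_apply, hu, ← hb] at this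
    simp at this
  have hrad : linP (b.coord 0) * W 0 + linP (b.coord 1) * W 1 + linP (b.coord 2) * W 2 = 0 :=
    p4_ext fun z => by
      have h := hom.rad z
      have h3' : om z (b 3) = 0 := by rw [hW, h3]; exact map_zero _
      rw [om_coords om b z z, h3', mul_zero, add_zero] at h
      simpa [eval_linP, hW] using h
  obtain ⟨d1, d2, d3, e0, e1, e2⟩ := koszul3 (b.coord 0) (b.coord 1) (b.coord 2) (by
    refine surj_pi _ (Submodule.span ℂ {b 3}) ?_ fun z hz => ?_
    · rw [finrank_span_singleton (b.ne_zero 3)]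
    · have h0 := hz 0
      have h1 := hz 1
      have h2 := hz 2
      simp only [Matrix.cons_val] at h0 h1 h2
      rw [sum_four b z, h0, h1, h2]
      simp only [zero_smul, zero_add]
      exact Submodule.smul_mem _ _ (Submodule.mem_span_singleton_self _)) _ _ _ hrad
  refine fin2 hom b (fun _ => b 3) 0 (by omega) analyticOnNhd_const (fun t z => by simp)
    ![0, 0, 0, 1] (fun j => linP (b.coord j)) W ?_ hy hW d1 d2 d3 0 ?_ ?_ ?_ ?_
  · intro z j
    fin_cases j <;> simp
  · simp only [Matrix.cons_val, e0]; ring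
  · simp only [Matrix.cons_val, e1]; ring
  · simp only [Matrix.cons_val, e2]; ring
  · simp only [Matrix.cons_val, h3]; ring

theorem case_B {om : Cn 4 → Cn 4 →ₗ[ℂ] ℂ} {d : ℕ} (hom : OmDat om d) (hd : 1 ≤ d)
    (T : Module.End ℂ (Cn 4)) (hT : ∀ z, om z (T z) = 0)
    (hZ : dimH {z : Cn 4 | z ≠ 0 ∧ om z = 0} ≤ 4)
    (hfree : ∀ q : Cn 4, q ≠ 0 → ∃ X Y : Cn 4 → Cn 4, AnalyticAt ℂ X q ∧ AnalyticAt ℂ Y q ∧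
      ∀ᶠ z in 𝓝 q, ∀ v, om z v = dt ![X z, Y z, z, v])
    (hker : Module.finrank ℂ (LinearMap.ker T) = 2) (hT2 : T * T ≠ 0) : OmSplits om := by
  have hvan := om_vanish hom hd T hT hZ hfree hker hT2
  have hr : Module.finrank ℂ (LinearMap.range T) = 2 := by
    have := LinearMap.finrank_range_add_finrank_ker T
    rw [hker] at this
    simp at this
    omega
  obtain ⟨b, -, m2, m3, hb⟩ := flag2 (LinearMap.range T) ⊤ hr (by simp)
  obtain ⟨W, hW⟩ := om_polys hom b
  have hy : ∀ z j, MvPolynomial.eval z (linP (b.coord j)) = b.coord j z := fun z j => eval_linP _ z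
  have hl : ∀ z j, MvPolynomial.eval z (linP (b.coord j ∘ₗ T)) = b.coord j (T z) :=
    fun z j => eval_linP _ z
  have hl0 : ∀ z, b.coord 0 (T z) = 0 := fun z => (hb _ ⟨z, rfl⟩).1
  have hl1 : ∀ z, b.coord 1 (T z) = 0 := fun z => (hb _ ⟨z, rfl⟩).2
  have hTz : ∀ z, T z = b.coord 2 (T z) • b 2 + b.coord 3 (T z) • b 3 := by
    intro z
    conv_lhs => rw [sum_four b (T z), hl0, hl1]
    simp only [zero_smul, zero_add]
  have l0 : linP (b.coord 0 ∘ₗ T) = 0 := p4_ext fun z => by rw [hl, hl0, map_zero]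
  have l1 : linP (b.coord 1 ∘ₗ T) = 0 := p4_ext fun z => by rw [hl, hl1, map_zero]
  have sl : Function.Surjective (LinearMap.pi ![b.coord 2 ∘ₗ T, b.coord 3 ∘ₗ T]) := by
    refine surj_pi _ (LinearMap.ker T) (by omega) fun z hz => ?_
    have h0 := hz 0
    have h1 := hz 1
    simp only [Matrix.cons_val, LinearMap.comp_apply] at h0 h1
    rw [LinearMap.mem_ker, hTz z, h0, h1]
    simp
  have sy' : ∀ z, b.coord 0 z = 0 → b.coord 1 z = 0 → z = b.coord 2 z • b 2 + b.coord 3 z • b 3 := by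
    intro z h0 h1
    conv_lhs => rw [sum_four b z, h0, h1]
    simp only [zero_smul, zero_add]
  have sy : Function.Surjective (LinearMap.pi ![b.coord 0, b.coord 1]) := by
    refine surj_pi _ (LinearMap.range T) (by omega) fun z hz => ?_
    have h0 := hz 0
    have h1 := hz 1
    simp only [Matrix.cons_val] at h0 h1
    rw [sy' z h0 h1]
    exact add_mem (Submodule.smul_mem _ _ m2) (Submodule.smul_mem _ _ m3)
  obtain ⟨h, e2, e3⟩ := koszul2 (b.coord 2 ∘ₗ T) (b.coord 3 ∘ₗ T) sl (W 2) (W 3) (p4_ext fun z => by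
    have h := hT z
    rw [om_coords om b z (T z), hl0, hl1, hW, hW, hW, hW] at h
    simp only [map_add, map_mul, hl]
    rw [map_zero]
    linear_combination h)
  have hrad : linP (b.coord 0) * W 0 + linP (b.coord 1) * W 1
      + h * (linP (b.coord 3 ∘ₗ T) * linP (b.coord 2) - linP (b.coord 2 ∘ₗ T) * linP (b.coord 3)) = 0 :=
    p4_ext fun z => by
      have h := hom.rad z
      rw [om_coords om b z z, hW, hW, hW, hW, e2, e3] at h
      simp only [map_add, map_mul, hl, hy, map_sub, map_neg] at h ⊢
      rw [map_zero]
      linear_combination h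
  -- h lies in the ideal (y0, y1)
  have hmem : ∃ a : Fin 2 → P4, h = ∑ i, linP (![b.coord 0, b.coord 1] i) * a i := by
    by_cases hN : ∃ z, (b.coord 0 z = 0 ∧ b.coord 1 z = 0) ∧
        b.coord 3 (T z) * b.coord 2 z - b.coord 2 (T z) * b.coord 3 z ≠ 0
    · refine mem_of_mul _ sy h (linP (b.coord 3 ∘ₗ T) * linP (b.coord 2)
        - linP (b.coord 2 ∘ₗ T) * linP (b.coord 3)) (fun z hz => ?_) ?_
      · have h0 := hz 0
        have h1 := hz 1
        simp only [Matrix.cons_val] at h0 h1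
        have := congrArg (MvPolynomial.eval z) hrad
        simp only [map_add, map_mul, hy, h0, h1, zero_mul, zero_add] at this
        rw [this, map_zero]
      · obtain ⟨z, ⟨h0, h1⟩, h2⟩ := hN
        refine ⟨z, fun i => ?_, ?_⟩
        · fin_cases i
          · exact h0
          · exact h1
        · simpa only [map_sub, map_mul, hl, hy] using h2
    · push Not at hN
      have c01 : b.coord 0 (b 2) = 0 ∧ b.coord 1 (b 2) = 0 := hb _ m2
      have c02 : b.coord 0 (b 3) = 0 ∧ b.coord 1 (b 3) = 0 := hb _ m3
      have c22 : b.coord 2 (b 2) = 1 := by simp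
      have c33 : b.coord 3 (b 3) = 1 := by simp
      have c23 : b.coord 2 (b 3) = 0 := by simp
      have c32 : b.coord 3 (b 2) = 0 := by simp
      have n2 := hN (b 2) c01
      have n3 := hN (b 3) c02
      have n23 := hN (b 2 + b 3) (by
        rw [map_add, map_add, c01.1, c01.2, c02.1, c02.2]; simp)
      simp only [map_add, c22, c33, c23, c32] at n2 n3 n23
      set lam := b.coord 2 (T (b 2)) with hlam
      have t2 : T (b 2) = lam • b 2 := by
        rw [hTz (b 2), show b.coord 3 (T (b 2)) = 0 by linear_combination n2]; simp [hlam]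
      have t3 : T (b 3) = lam • b 3 := by
        rw [hTz (b 3), show b.coord 2 (T (b 3)) = 0 by linear_combination -n3,
          show b.coord 3 (T (b 3)) = lam by linear_combination n23 - n2 - n3]
        simp
      have tt : ∀ z, T (T z) = lam • T z := by
        intro z
        rw [hTz z]
        simp only [map_add, map_smul, t2, t3, smul_add]
        rw [smul_comm, smul_comm _ lam]
      have hlam0 : lam ≠ 0 := by
        intro h0
        apply hT2
        refine LinearMap.ext fun z => ?_
        change T (T z) = 0
        rw [tt, h0, zero_smul]
      have hT' : ∀ z, om z ((T - lam • (1 : Module.End ℂ (Cn 4))) z) = 0 := by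
        intro z
        simp [hT z, hom.rad z]
      have hk : LinearMap.ker (T - lam • (1 : Module.End ℂ (Cn 4))) = LinearMap.range T := by
        ext z
        rw [LinearMap.mem_ker]
        constructor
        · intro hz
          have hz' : T z = lam • z := by simpa [sub_eq_zero] using hz
          exact ⟨lam⁻¹ • z, by rw [map_smul, hz', smul_smul, inv_mul_cancel₀ hlam0, one_smul]⟩
        · rintro ⟨u, rfl⟩
          simp [tt]
      have hv2 := om_vanish hom hd _ hT' hZ hfree (by rw [hk, hr]) (by
        intro h0
        have hne : LinearMap.ker T ≠ ⊥ := by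
          intro h; rw [h] at hker; simp at hker
        obtain ⟨u, hu, hu0⟩ := Submodule.exists_mem_ne_zero_of_ne_bot hne
        have := LinearMap.congr_fun h0 u
        rw [LinearMap.mem_ker] at hu
        simp [hu, hlam0, hu0] at this)
      refine mem_of_mul _ sy h (linP (b.coord 2 ∘ₗ T)) (fun z hz => ?_) ⟨b 2, fun i => ?_, ?_⟩
      · have h0 := hz 0
        have h1 := hz 1
        simp only [Matrix.cons_val] at h0 h1
        have hzr : z ∈ LinearMap.range T := by
          rw [sy' z h0 h1]
          exact add_mem (Submodule.smul_mem _ _ m2) (Submodule.smul_mem _ _ m3)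
        rw [← hk] at hzr
        have h3 := hW z 3
        rw [hv2 z hzr, e3] at h3
        simp only [map_neg, map_mul, LinearMap.zero_apply] at h3
        linear_combination h3
      · fin_cases i
        · exact c01.1
        · exact c01.2
      · rw [hl]; exact hlam0
  obtain ⟨a, ha⟩ := hmem
  rw [Fin.sum_univ_two] at ha
  simp only [Matrix.cons_val] at ha
  obtain ⟨g, g0, g1⟩ := koszul2 (b.coord 0) (b.coord 1) sy
    (W 0 + a 0 * (linP (b.coord 3 ∘ₗ T) * linP (b.coord 2) - linP (b.coord 2 ∘ₗ T) * linP (b.coord 3)))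
    (W 1 + a 1 * (linP (b.coord 3 ∘ₗ T) * linP (b.coord 2) - linP (b.coord 2 ∘ₗ T) * linP (b.coord 3)))
    (by rw [ha] at hrad; linear_combination hrad)
  have hg : ∃ a : Fin 2 → P4, g = ∑ i, linP (![b.coord 2 ∘ₗ T, b.coord 3 ∘ₗ T] i) * a i := by
    obtain ⟨u, hu, hu'⟩ : ∃ u, T u = 0 ∧ ¬ (b.coord 0 u = 0 ∧ b.coord 1 u = 0) := by
      by_contra hcon
      push Not at hcon
      have hle : LinearMap.ker T ≤ LinearMap.range T := by
        intro u hu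
        obtain ⟨h0, h1⟩ := hcon u hu
        rw [sy' u h0 h1]
        exact add_mem (Submodule.smul_mem _ _ m2) (Submodule.smul_mem _ _ m3)
      have heq := Submodule.eq_of_le_of_finrank_eq hle (by rw [hker, hr])
      apply hT2
      refine LinearMap.ext fun z => ?_
      have : T z ∈ LinearMap.ker T := by rw [heq]; exact ⟨z, rfl⟩
      exact this
    have key : ∀ z, (∀ i, ![b.coord 2 ∘ₗ T, b.coord 3 ∘ₗ T] i z = 0) →
        MvPolynomial.eval z g * b.coord 0 z = 0 ∧ MvPolynomial.eval z g * b.coord 1 z = 0 := by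
      intro z hz
      have h0 := hz 0
      have h1 := hz 1
      simp only [Matrix.cons_val, LinearMap.comp_apply] at h0 h1
      have hz0 : T z = 0 := by rw [hTz z, h0, h1]; simp
      have w0 := hW z 0
      have w1 := hW z 1
      rw [hvan z hz0] at w0 w1
      simp only [LinearMap.zero_apply] at w0 w1
      have g0' := congrArg (MvPolynomial.eval z) g0
      have g1' := congrArg (MvPolynomial.eval z) g1
      simp only [map_add, map_mul, map_sub, map_neg, hl, hy, h0, h1, ← w0, ← w1] at g0' g1'
      constructor
      · linear_combination g1'
      · linear_combination -g0'
    have hu2 : ∀ i, ![b.coord 2 ∘ₗ T, b.coord 3 ∘ₗ T] i u = 0 := by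
      intro i
      fin_cases i <;> simp [hu]
    by_cases h0 : b.coord 0 u = 0
    · refine mem_of_mul _ sl g (linP (b.coord 1)) (fun z hz => ?_) ⟨u, hu2, ?_⟩
      · rw [hy]; exact (key z hz).2
      · rw [hy]; exact fun h1 => hu' ⟨h0, h1⟩
    · refine mem_of_mul _ sl g (linP (b.coord 0)) (fun z hz => ?_) ⟨u, hu2, ?_⟩
      · rw [hy]; exact (key z hz).1
      · rw [hy]; exact h0
  obtain ⟨β, hβ⟩ := hg
  rw [Fin.sum_univ_two] at hβ
  simp only [Matrix.cons_val] at hβ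
  refine fin2 hom b (fun z => T z) 1 hd ?_ (fun t z => by simp)
    (fun j => linP (b.coord j ∘ₗ T)) (fun j => linP (b.coord j)) W hl hy hW
    (-(a 1)) (a 0) (β 1) (-(β 0)) ?_ ?_ ?_ ?_
  · intro z _
    exact (LinearMap.toContinuousLinearMap T).analyticAt z
  · simp only [l0, l1]
    rw [hβ] at g0
    linear_combination g0
  · simp only [l0, l1]
    rw [hβ] at g1
    linear_combination g1
  · simp only [l0, l1]
    rw [e2, ha]; ring
  · simp only [l0, l1]
    rw [e3, ha]; ring

theorem case_C {om : Cn 4 → Cn 4 →ₗ[ℂ] ℂ} {d : ℕ} (hom : OmDat om d) (hd : 1 ≤ d)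
    (T : Module.End ℂ (Cn 4)) (hT : ∀ z, om z (T z) = 0)
    (hker : Module.finrank ℂ (LinearMap.ker T) = 1)
    (hall : ∀ c : ℂ, Module.finrank ℂ (LinearMap.ker (T - c • (1 : Module.End ℂ (Cn 4)))) ≤ 1) :
    OmSplits om := by
  have hr : Module.finrank ℂ (LinearMap.range T) = 3 := by
    have := LinearMap.finrank_range_add_finrank_ker T
    rw [hker] at this
    simp at this
    omega
  -- an eigenvalue on the range
  obtain ⟨μ, U, hU, hUH, hUT⟩ : ∃ (μ : ℂ) (U : Submodule ℂ (Cn 4)), Module.finrank ℂ U = 2 ∧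
      U ≤ LinearMap.range T ∧ ∀ z ∈ LinearMap.range T, T z - μ • z ∈ U := by
    have hinv : ∀ z ∈ LinearMap.range T, T z ∈ LinearMap.range T := fun z _ => ⟨z, rfl⟩
    have hnt : Nontrivial (LinearMap.range T) := Module.nontrivial_of_finrank_pos (R := ℂ) (by omega)
    obtain ⟨μ, hμ⟩ := Module.End.exists_eigenvalue (T.restrict hinv)
    obtain ⟨v, hv⟩ := hμ.exists_hasEigenvector
    have hv1 : T v = μ • (v : Cn 4) := congrArg Subtype.val hv.apply_eq_smul
    have hv0 : (v : Cn 4) ≠ 0 := fun h => hv.2 (Subtype.ext h)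
    let f : LinearMap.range T →ₗ[ℂ] Cn 4 :=
      (T - μ • (1 : Module.End ℂ (Cn 4))) ∘ₗ (LinearMap.range T).subtype
    have hf : ∀ x, f x = T x - μ • (x : Cn 4) := fun x => by simp [f]
    refine ⟨μ, LinearMap.range f, ?_, ?_, ?_⟩
    · have h1 := LinearMap.finrank_range_add_finrank_ker f
      have h2 : Module.finrank ℂ (LinearMap.ker f) ≤ 1 := by
        refine le_trans ?_ (hall μ)
        have hle : (LinearMap.ker f).map (LinearMap.range T).subtype ≤
            LinearMap.ker (T - μ • (1 : Module.End ℂ (Cn 4))) := by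
          rintro _ ⟨x, hx, rfl⟩
          exact hx
        rw [← LinearEquiv.finrank_eq (Submodule.equivMapOfInjective _
          (LinearMap.range T).injective_subtype (LinearMap.ker f)).symm]
        exact Submodule.finrank_mono hle
      have h3 : 1 ≤ Module.finrank ℂ (LinearMap.ker f) := by
        rw [Submodule.one_le_finrank_iff]
        intro h
        have : v ∈ LinearMap.ker f := by rw [LinearMap.mem_ker, hf, hv1, sub_self]
        rw [h, Submodule.mem_bot] at this
        exact hv0 (by rw [this]; rfl)
      omega
    · rintro _ ⟨x, rfl⟩
      rw [hf]
      exact sub_mem (hinv _ x.2) (Submodule.smul_mem _ _ x.2)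
    · intro z hz
      exact ⟨⟨z, hz⟩, hf _⟩
  obtain ⟨b, m1, m2, m3, hb⟩ := flag2 U (LinearMap.range T) hU (by omega)
  obtain ⟨W, hW⟩ := om_polys hom b
  have hy : ∀ z j, MvPolynomial.eval z (linP (b.coord j)) = b.coord j z := fun z j => eval_linP _ z
  have hl : ∀ z j, MvPolynomial.eval z (linP (b.coord j ∘ₗ T)) = b.coord j (T z) :=
    fun z j => eval_linP _ z
  have hl0 : ∀ z, b.coord 0 (T z) = 0 := fun z =>
    mem_flag b ![1, 2, 3] (by decide) _ hr (by
      intro j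
      fin_cases j
      · exact m1
      · exact hUH m2
      · exact hUH m3) _ ⟨z, rfl⟩ 0 (by decide)
  have l0 : linP (b.coord 0 ∘ₗ T) = 0 := p4_ext fun z => by rw [hl, hl0, map_zero]
  have hTz : ∀ z, T z = b.coord 1 (T z) • b 1 + b.coord 2 (T z) • b 2 + b.coord 3 (T z) • b 3 := by
    intro z
    conv_lhs => rw [sum_four b (T z), hl0]
    simp only [zero_smul, zero_add]
  have c11 : b.coord 1 (b 1) = 1 := by simp
  have c22 : b.coord 2 (b 2) = 1 := by simp
  have c33 : b.coord 3 (b 3) = 1 := by simp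
  have c23 : b.coord 2 (b 3) = 0 := by simp
  have c32 : b.coord 3 (b 2) = 0 := by simp
  set c0 := b.coord 1 (T (b 0)) with hc0
  have hl1 : ∀ z, b.coord 1 (T z) = μ * b.coord 1 z + c0 * b.coord 0 z := by
    intro z
    have a1 := (hb _ (hUT _ m1)).2
    have a2 := (hb _ (hUT _ (hUH m2))).2
    have a3 := (hb _ (hUT _ (hUH m3))).2
    rw [map_sub, map_smul, smul_eq_mul] at a1 a2 a3
    rw [c11] at a1
    rw [(hb _ m2).2] at a2
    rw [(hb _ m3).2] at a3
    conv_lhs => rw [sum_four b z]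
    simp only [map_add, map_smul, smul_eq_mul]
    rw [← hc0]
    linear_combination b.coord 1 z * a1 + b.coord 2 z * a2 + b.coord 3 z * a3
  have l1 : linP (b.coord 1 ∘ₗ T) = MvPolynomial.C μ * linP (b.coord 1)
      + MvPolynomial.C c0 * linP (b.coord 0) := p4_ext fun z => by
    simp only [map_add, map_mul, hl, hy, MvPolynomial.eval_C, hl1]
  have lM : ∀ j, linP (b.coord j ∘ₗ (T - μ • (1 : Module.End ℂ (Cn 4)))) =
      linP (b.coord j ∘ₗ T) - MvPolynomial.C μ * linP (b.coord j) := fun j => p4_ext fun z => by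
    simp only [map_sub, map_mul, hl, hy, MvPolynomial.eval_C, eval_linP, LinearMap.comp_apply]
    simp
  have sl : Function.Surjective
      (LinearMap.pi ![b.coord 1 ∘ₗ T, b.coord 2 ∘ₗ T, b.coord 3 ∘ₗ T]) := by
    refine surj_pi _ (LinearMap.ker T) (by omega) fun z hz => ?_
    have h0 := hz 0
    have h1 := hz 1
    have h2 := hz 2
    simp only [Matrix.cons_val, LinearMap.comp_apply] at h0 h1 h2
    rw [LinearMap.mem_ker, hTz z, h0, h1, h2]
    simp
  have sy' : ∀ z, b.coord 0 z = 0 → b.coord 1 z = 0 → z = b.coord 2 z • b 2 + b.coord 3 z • b 3 := by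
    intro z h0 h1
    conv_lhs => rw [sum_four b z, h0, h1]
    simp only [zero_smul, zero_add]
  have sy : Function.Surjective (LinearMap.pi ![b.coord 0, b.coord 1]) := by
    refine surj_pi _ U (by omega) fun z hz => ?_
    have h0 := hz 0
    have h1 := hz 1
    simp only [Matrix.cons_val] at h0 h1
    rw [sy' z h0 h1]
    exact add_mem (Submodule.smul_mem _ _ m2) (Submodule.smul_mem _ _ m3)
  have sM : Function.Surjective
      (LinearMap.pi ![b.coord 2 ∘ₗ (T - μ • (1 : Module.End ℂ (Cn 4))),
        b.coord 3 ∘ₗ (T - μ • (1 : Module.End ℂ (Cn 4))), b.coord 0]) := by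
    refine surj_pi _ (LinearMap.ker (T - μ • (1 : Module.End ℂ (Cn 4))))
      (by have := hall μ; omega) fun z hz => ?_
    have h0 := hz 0
    have h1 := hz 1
    have h2 := hz 2
    simp only [Matrix.cons_val, LinearMap.comp_apply] at h0 h1 h2
    have hz : ∀ x, (T - μ • (1 : Module.End ℂ (Cn 4))) x = T x - μ • x := fun x => by simp
    rw [LinearMap.mem_ker, sum_four b ((T - μ • (1 : Module.End ℂ (Cn 4))) z), h0, h1, hz]
    rw [map_sub, map_sub, map_smul, map_smul, hl0, hl1, h2]
    simp
  obtain ⟨c1, c2, c3, e1, e2, e3⟩ := koszul3 (b.coord 1 ∘ₗ T) (b.coord 2 ∘ₗ T) (b.coord 3 ∘ₗ T) sl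
    (W 1) (W 2) (W 3) (p4_ext fun z => by
      have h := hT z
      rw [om_coords om b z (T z), hl0, hW, hW, hW, hW] at h
      simp only [map_add, map_mul, hl]
      rw [map_zero]
      linear_combination h)
  have hrad : linP (b.coord 0) * W 0 + linP (b.coord 1) * W 1 + linP (b.coord 2) * W 2
      + linP (b.coord 3) * W 3 = 0 :=
    p4_ext fun z => by
      have h := hom.rad z
      rw [om_coords om b z z, hW, hW, hW, hW] at h
      simp only [map_add, map_mul, hl, hy, map_sub, map_neg] at h ⊢
      rw [map_zero]
      linear_combination h
  rw [e1, e2, e3] at hrad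
  have hN : ∃ z, (b.coord 0 z = 0 ∧ b.coord 1 z = 0) ∧
      b.coord 2 z * b.coord 3 (T z) - b.coord 3 z * b.coord 2 (T z) ≠ 0 := by
    by_contra hN
    push Not at hN
    have n2 := hN (b 2) (hb _ m2)
    have n3 := hN (b 3) (hb _ m3)
    have n23 := hN (b 2 + b 3) (hb _ (add_mem m2 m3))
    simp only [map_add, c22, c33, c23, c32] at n2 n3 n23
    set lam := b.coord 2 (T (b 2)) with hlam
    have t2 : T (b 2) = lam • b 2 := by
      rw [hTz (b 2), show b.coord 3 (T (b 2)) = 0 by linear_combination n2, hl1,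
        (hb _ m2).1, (hb _ m2).2]
      simp [hlam]
    have t3 : T (b 3) = lam • b 3 := by
      rw [hTz (b 3), show b.coord 2 (T (b 3)) = 0 by linear_combination -n3,
        show b.coord 3 (T (b 3)) = lam by linear_combination n23 - n2 - n3, hl1,
        (hb _ m3).1, (hb _ m3).2]
      simp
    have hli : LinearIndependent ℂ (b ∘ ![2, 3]) := b.linearIndependent.comp _ (by decide)
    have hle : Submodule.span ℂ (Set.range (b ∘ ![2, 3])) ≤
        LinearMap.ker (T - lam • (1 : Module.End ℂ (Cn 4))) := by
      rw [Submodule.span_le]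
      rintro _ ⟨j, rfl⟩
      fin_cases j
      · simp [t2]
      · simp [t3]
    have h5 := Submodule.finrank_mono hle
    rw [finrank_span_eq_card hli, Fintype.card_fin] at h5
    have := hall lam
    omega
  obtain ⟨a, ha⟩ : ∃ a : Fin 2 → P4, c1 = ∑ i, linP (![b.coord 0, b.coord 1] i) * a i := by
    refine mem_of_mul _ sy c1 (linP (b.coord 2) * linP (b.coord 3 ∘ₗ T)
        - linP (b.coord 3) * linP (b.coord 2 ∘ₗ T)) (fun z hz => ?_) ?_
    · have h0 := hz 0
      have h1 := hz 1
      simp only [Matrix.cons_val] at h0 h1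
      have := congrArg (MvPolynomial.eval z) hrad
      simp only [map_add, map_mul, map_sub, hy, hl, hl1, h0, h1] at this ⊢
      rw [map_zero] at this
      linear_combination this
    · obtain ⟨z, ⟨h0, h1⟩, h2⟩ := hN
      refine ⟨z, fun i => ?_, ?_⟩
      · fin_cases i
        · exact h0
        · exact h1
      · simpa only [map_sub, map_mul, hl, hy] using h2
  rw [Fin.sum_univ_two] at ha
  simp only [Matrix.cons_val] at ha
  rw [l1] at e2 e3 hrad
  obtain ⟨r, r0, r1⟩ := koszul2 (b.coord 0) (b.coord 1) sy
    (W 0 + a 0 * (linP (b.coord 2) * linP (b.coord 3 ∘ₗ T) - linP (b.coord 3) * linP (b.coord 2 ∘ₗ T))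
      + MvPolynomial.C c0 * (c2 * linP (b.coord 3) - c3 * linP (b.coord 2)))
    ((a 1 * linP (b.coord 2) - c2) * (linP (b.coord 3 ∘ₗ T) - MvPolynomial.C μ * linP (b.coord 3))
      - (a 1 * linP (b.coord 3) - c3) * (linP (b.coord 2 ∘ₗ T) - MvPolynomial.C μ * linP (b.coord 2)))
    (by rw [ha] at hrad; linear_combination hrad)
  obtain ⟨d1, d2, d3, f1, f2, f3⟩ := koszul3 _ _ _ sM (c3 - a 1 * linP (b.coord 3))
    (a 1 * linP (b.coord 2) - c2) r (by rw [lM, lM]; linear_combination r1)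
  rw [lM] at f1 f2
  rw [lM, lM] at f3
  have g2 : c2 = a 1 * linP (b.coord 2) - linP (b.coord 0) * d1
      + (linP (b.coord 2 ∘ₗ T) - MvPolynomial.C μ * linP (b.coord 2)) * d3 := by
    linear_combination -f2
  have g3 : c3 = a 1 * linP (b.coord 3) - linP (b.coord 0) * d2
      + (linP (b.coord 3 ∘ₗ T) - MvPolynomial.C μ * linP (b.coord 3)) * d3 := by
    linear_combination f1
  rw [g2, g3] at e1 r0
  rw [ha, g3] at e2
  rw [ha, g2] at e3
  rw [f3] at r0
  refine fin2 hom b (fun z => T z) 1 hd ?_ (fun t z => by simp)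
    (fun j => linP (b.coord j ∘ₗ T)) (fun j => linP (b.coord j)) W hl hy hW
    (-(a 1 - d3 * MvPolynomial.C μ)) (a 0 - d3 * MvPolynomial.C c0) (-d1) (-d2) ?_ ?_ ?_ ?_
  · intro z _
    exact (LinearMap.toContinuousLinearMap T).analyticAt z
  · simp only [l0, l1]
    linear_combination r0
  · simp only [l0, l1]
    linear_combination e1
  · simp only [l0, l1]
    linear_combination e2
  · simp only [l0, l1]
    linear_combination e3

theorem om_main {om : Cn 4 → Cn 4 →ₗ[ℂ] ℂ} {d : ℕ} (hom : OmDat om d) (hd : 1 ≤ d)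
    (hZ : dimH {z : Cn 4 | z ≠ 0 ∧ om z = 0} ≤ 4)
    (hfree : ∀ q : Cn 4, q ≠ 0 → ∃ X Y : Cn 4 → Cn 4, AnalyticAt ℂ X q ∧ AnalyticAt ℂ Y q ∧
      ∀ᶠ z in 𝓝 q, ∀ v, om z v = dt ![X z, Y z, z, v])
    (S : Module.End ℂ (Cn 4)) (hS : ∀ z, om z (S z) = 0)
    (hnil : ∀ c : ℂ, ¬ IsNilpotent (S + c • LinearMap.id)) : OmSplits om := by
  have hT : ∀ (c : ℂ) z, om z ((S - c • (1 : Module.End ℂ (Cn 4))) z) = 0 := by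
    intro c z
    simp [hS z, hom.rad z]
  have hnil' : ∀ c : ℂ, ¬ IsNilpotent (S - c • (1 : Module.End ℂ (Cn 4))) := by
    intro c
    have e : S - c • (1 : Module.End ℂ (Cn 4)) = S + (-c) • LinearMap.id :=
      LinearMap.ext fun z => by simp [sub_eq_add_neg]
    rw [e]
    exact hnil (-c)
  by_cases h2 : ∃ c : ℂ, 2 ≤ Module.finrank ℂ (LinearMap.ker (S - c • (1 : Module.End ℂ (Cn 4))))
  · obtain ⟨c, hc⟩ := h2
    have hle := (LinearMap.ker (S - c • (1 : Module.End ℂ (Cn 4)))).finrank_le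
    rw [Module.finrank_fin_fun] at hle
    have h4 : Module.finrank ℂ (LinearMap.ker (S - c • (1 : Module.End ℂ (Cn 4)))) ≠ 4 := by
      intro h4
      have := Submodule.eq_top_of_finrank_eq (S := LinearMap.ker (S - c • (1 : Module.End ℂ (Cn 4))))
        (by rw [h4, Module.finrank_fin_fun])
      rw [LinearMap.ker_eq_top] at this
      exact hnil' c (by rw [this]; exact IsNilpotent.zero)
    by_cases h3 : Module.finrank ℂ (LinearMap.ker (S - c • (1 : Module.End ℂ (Cn 4)))) = 3
    · exact case_A hom _ (hT c) h3
    · refine case_B hom hd _ (hT c) hZ hfree (by omega) fun h0 => hnil' c ⟨2, ?_⟩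
      rw [pow_two, h0]
  · push Not at h2
    obtain ⟨c, hc⟩ := Module.End.exists_eigenvalue S
    refine case_C hom hd _ (hT c) ?_ fun e => ?_
    · refine le_antisymm (by have := h2 c; omega) ?_
      rw [Submodule.one_le_finrank_iff]
      intro h
      obtain ⟨v, hv⟩ := hc.exists_hasEigenvector
      have : v ∈ LinearMap.ker (S - c • (1 : Module.End ℂ (Cn 4))) := by
        rw [LinearMap.mem_ker]
        simp [hv.apply_eq_smul]
      rw [h, Submodule.mem_bot] at this
      exact hv.2 this
    · have := h2 (c + e)
      rw [sub_sub, ← add_smul]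
      omega

theorem form_dt (θ : AlternatingMap ℂ (Cn 4) ℂ (Fin 4)) (v : Fin 4 → Cn 4) :
    θ v = θ (Pi.basisFun ℂ (Fin 4)) * dt v := by
  conv_lhs => rw [AlternatingMap.eq_smul_basis_det (Pi.basisFun ℂ (Fin 4)) θ]
  rfl

/-- Corollary 6.2: Let `D` be a codimension one singular holomorphic
distribution on `ℙ³` with locally free tangent sheaf, `deg D ≥ 1`, tangent to a
nonnilpotent holomorphic vector field on `ℙ³` (i.e. one none of whose linear
representatives `S + c·id` on `ℂ⁴` is nilpotent). Then `T_D` splits. -/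
theorem statement_19 (D : ProjDist 3 2) (hfree : PLocFree D) (hd : 1 ≤ D.d)
    (hvf : ∃ S : Module.End ℂ (Cn 4), (∀ c : ℂ, ¬ IsNilpotent (S + c • LinearMap.id)) ∧
      ∀ (z : Cn 4) (v : Fin (3 - 2) → Cn 4) (i : Fin (3 - 2)), v i = S z → D.ω z v = 0) :
    PSplits (by omega) D := by
  obtain ⟨S, hnil, hS⟩ := hvf
  let om : Cn 4 → Cn 4 →ₗ[ℂ] ℂ := fun z =>
    (D.ω z).toMultilinearMap.toLinearMap (fun _ => 0) (⟨0, by omega⟩ : Fin (3 - 2))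
  have hv1 : ∀ v : Fin (3 - 2) → Cn 4, v = fun _ => v (⟨0, by omega⟩ : Fin (3 - 2)) := by
    intro v
    funext i
    exact congrArg v (Subsingleton.elim (α := Fin 1) i _)
  have hom1 : ∀ z v, om z v = D.ω z (fun _ => v) := by
    intro z v
    change D.ω z (Function.update (fun _ => 0) (⟨0, by omega⟩ : Fin (3 - 2)) v) = _
    congr 1
    funext i
    have : i = (⟨0, by omega⟩ : Fin (3 - 2)) := Subsingleton.elim (α := Fin 1) i _
    rw [this, Function.update_self]
  have hom2 : ∀ z (v : Fin (3 - 2) → Cn 4), D.ω z v = om z (v (⟨0, by omega⟩ : Fin (3 - 2))) := by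
    intro z v
    rw [hom1, ← hv1 v]
  have hom : OmDat om D.d := by
    refine ⟨fun v => ?_, fun t z v => ?_, fun z => ?_⟩
    · simp only [hom1]
      exact D.hol _
    · rw [hom1, hom1]
      exact D.homog t z _
    · rw [hom1]
      exact D.radial z _ (⟨0, by omega⟩ : Fin (3 - 2)) rfl
  have hz0 : {z : Cn 4 | z ≠ 0 ∧ om z = 0} = {z : Cn 4 | z ≠ 0 ∧ D.ω z = 0} := by
    ext z
    refine and_congr_right fun _ => ⟨fun h => ?_, fun h => ?_⟩
    · ext v
      rw [hom2, h]
      rfl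
    · refine LinearMap.ext fun v => ?_
      rw [hom1, h]
      rfl
  have hZ : dimH {z : Cn 4 | z ≠ 0 ∧ om z = 0} ≤ 4 := by
    rw [hz0]
    rcases D.codim with h | h
    · have h' : {z : Cn 4 | z ≠ 0 ∧ D.ω z = 0} = ∅ := h
      rw [h', dimH_empty]
      exact zero_le
    · have h' : dimH {z : Cn 4 | z ≠ 0 ∧ D.ω z = 0} + 4 ≤ 4 + 4 := by
        refine (le_of_eq ?_).trans (h.trans (le_of_eq ?_))
        · congr 1; norm_num
        · norm_num
      exact (ENNReal.add_le_add_iff_right (by norm_num)).1 h'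
  have hfree' : ∀ q : Cn 4, q ≠ 0 → ∃ X Y : Cn 4 → Cn 4, AnalyticAt ℂ X q ∧ AnalyticAt ℂ Y q ∧
      ∀ᶠ z in 𝓝 q, ∀ v, om z v = dt ![X z, Y z, z, v] := by
    intro q hq
    obtain ⟨X, Y, Θ, hX, hY, hΘ, h⟩ := hfree q hq
    have hu := hΘ (Pi.basisFun ℂ (Fin 4))
    refine ⟨fun z => Θ z (Pi.basisFun ℂ (Fin 4)) • X z, Y, hu.smul hX, hY, ?_⟩
    filter_upwards [h] with z hz v
    rw [hom1, hz]
    have h4 : (Fin.cons (X z) (Fin.cons (Y z) (Fin.cons z fun _ => v)) : Fin 4 → Cn 4) =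
        ![X z, Y z, z, v] := by
      funext i
      fin_cases i <;> rfl
    refine (congrArg (Θ z) h4).trans ?_
    refine (form_dt (Θ z) _).trans ?_
    obtain ⟨g, hg⟩ := det_lin0 dt (Y z) z v
    rw [← hg, ← hg, map_smul, smul_eq_mul]
  obtain ⟨X1, X2, d1, d2, c, hc, hX1, hX2, hh1, hh2, h⟩ :=
    om_main hom hd hZ hfree' S (fun z => by rw [hom1]; exact hS z _ (⟨0, by omega⟩ : Fin (3 - 2)) rfl) hnil
  refine ⟨X1, X2, d1, d2, c, hc, hX1, hX2, hh1, hh2, fun z v => ?_⟩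
  rw [hom2, h, Pi.basisFun_det_apply]
  congr 2
  ext i j
  fin_cases i <;> rfl
end
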